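/- arXiv:1904.09284 — 4 statements merged into one kernel-verified Lean document; each statement's English description precedes it below -/
import Mathlib

section
/- If n balls are thrown independently and uniformly at random into n bins, then there exists a constant C_0 > 0 such that for all n and all k ≤ C_0·n, the expected number of balls N_k in the k most loaded bins satisfies E[N_k] = Ω(k · log(n/k) / log log(n/k)). -/
open Finset

/-- The number of balls in the `k` most loaded bins, when the balls-to-bins
assignment is `ω : Fin n → Fin n`. -/
def ballsInTopBins (n k : ℕ) (ω : Fin n → Fin n) : ℕ :=
  (Finset.univ.powersetCard k).sup
    (fun T => ∑ b ∈ T, (Finset.univ.filter (fun i => ω i = b)).card)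

/-- The indicator that the bin `b` receives at least one of the `s` balls thrown according to `φ`. -/
noncomputable def hitInd {n s : ℕ} (b : Fin n) (φ : Fin s → Fin n) : ℝ :=
  1 - ∏ j, (if φ j = b then (0 : ℝ) else 1)

lemma hitInd_eq_ite {n s : ℕ} (b : Fin n) (φ : Fin s → Fin n) :
    hitInd b φ = if ∃ j, φ j = b then 1 else 0 := by
  unfold hitInd
  split_ifs with h
  · obtain ⟨j, hj⟩ := h
    rw [Finset.prod_eq_zero (Finset.mem_univ j) (by simp [hj])]
    simp
  · push Not at h
    simp [h]

lemma sum_ite_eq_bin {n : ℕ} (b : Fin n) :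
    ∑ x : Fin n, (if x = b then (0 : ℝ) else 1) = n - 1 := by
  have h : ∀ x : Fin n, (if x = b then (0 : ℝ) else 1) = 1 - (if x = b then 1 else 0) := by
    intro x; split_ifs <;> simp
  simp [h]

lemma sum_ite_eq_bin_mul {n : ℕ} {a b : Fin n} (hab : a ≠ b) :
    ∑ x : Fin n, (if x = a then (0 : ℝ) else 1) * (if x = b then (0 : ℝ) else 1) = n - 2 := by
  have h : ∀ x : Fin n, (if x = a then (0 : ℝ) else 1) * (if x = b then (0 : ℝ) else 1) =
      1 - (if x = a then 1 else 0) - (if x = b then 1 else 0) := by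
    intro x
    by_cases h1 : x = a
    · have h2 : x ≠ b := fun h => hab (h1.symm.trans h)
      simp [h1, hab]
    · simp [h1]; split_ifs <;> simp
  simp only [h, Finset.sum_sub_distrib]
  simp; ring

lemma sum_hitInd {n : ℕ} (s : ℕ) (b : Fin n) :
    ∑ φ : Fin s → Fin n, hitInd b φ = (n : ℝ) ^ s - ((n : ℝ) - 1) ^ s := by
  simp only [hitInd, Finset.sum_sub_distrib]
  rw [← Fintype.sum_pow (fun x => if x = b then (0 : ℝ) else 1) s, sum_ite_eq_bin]
  simp

lemma sum_hitInd_mul {n : ℕ} (s : ℕ) {a b : Fin n} (hab : a ≠ b) :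
    ∑ φ : Fin s → Fin n, hitInd a φ * hitInd b φ =
      (n : ℝ) ^ s - 2 * ((n : ℝ) - 1) ^ s + ((n : ℝ) - 2) ^ s := by
  have h : ∀ φ : Fin s → Fin n, hitInd a φ * hitInd b φ = hitInd a φ -
      ∏ j, (if φ j = b then (0 : ℝ) else 1) +
      ∏ j, ((if φ j = a then (0 : ℝ) else 1) * (if φ j = b then (0 : ℝ) else 1)) := by
    intro φ
    rw [Finset.prod_mul_distrib]
    unfold hitInd
    ring
  simp only [h, Finset.sum_add_distrib, Finset.sum_sub_distrib]
  rw [← Fintype.sum_pow (fun x => if x = b then (0 : ℝ) else 1) s, sum_ite_eq_bin,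
    ← Fintype.sum_pow
      (fun x => (if x = a then (0 : ℝ) else 1) * (if x = b then (0 : ℝ) else 1)) s,
    sum_ite_eq_bin_mul hab, sum_hitInd]
  ring

lemma hitInd_nonneg {n s : ℕ} (b : Fin n) (φ : Fin s → Fin n) : 0 ≤ hitInd b φ := by
  rw [hitInd_eq_ite]; split_ifs <;> simp

lemma hitInd_mul_self {n s : ℕ} (b : Fin n) (φ : Fin s → Fin n) :
    hitInd b φ * hitInd b φ = hitInd b φ := by
  rw [hitInd_eq_ite]; split_ifs <;> simp

/-- Being hit is negatively correlated between distinct bins. -/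
lemma sum_hitInd_mul_le {n : ℕ} (hn : 2 ≤ n) (s : ℕ) {a b : Fin n} (hab : a ≠ b) :
    ∑ φ : Fin s → Fin n, hitInd a φ * hitInd b φ ≤
      ((n : ℝ) ^ s - ((n : ℝ) - 1) ^ s) ^ 2 / (n : ℝ) ^ s := by
  have hn' : (2 : ℝ) ≤ n := by exact_mod_cast hn
  rw [sum_hitInd_mul s hab, le_div_iff₀ (by positivity)]
  have h : ((n : ℝ) - 2) ^ s * (n : ℝ) ^ s ≤ (((n : ℝ) - 1) ^ s) ^ 2 := by
    rw [← mul_pow, pow_right_comm]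
    exact pow_le_pow_left₀ (mul_nonneg (by linarith) (by linarith)) (by nlinarith) s
  nlinarith

/-- The number of bins hit in each of the `t` rounds described by `ψ`. -/
noncomputable def numAlwaysHit {n t s : ℕ} (ψ : Fin t → Fin s → Fin n) : ℝ :=
  ∑ b, ∏ i, hitInd b (ψ i)

lemma sum_numAlwaysHit (n t s : ℕ) :
    ∑ ψ : Fin t → Fin s → Fin n, numAlwaysHit ψ =
      n * ((n : ℝ) ^ s - ((n : ℝ) - 1) ^ s) ^ t := by
  unfold numAlwaysHit
  rw [Finset.sum_comm]
  have h : ∀ b : Fin n, ∑ ψ : Fin t → Fin s → Fin n, ∏ i, hitInd b (ψ i) =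
      ((n : ℝ) ^ s - ((n : ℝ) - 1) ^ s) ^ t := by
    intro b
    rw [← Fintype.sum_pow (fun φ : Fin s → Fin n => hitInd b φ) t, sum_hitInd]
  simp [h]

lemma sum_numAlwaysHit_sq_le {n : ℕ} (hn : 2 ≤ n) (t s : ℕ) :
    ∑ ψ : Fin t → Fin s → Fin n, numAlwaysHit ψ ^ 2 ≤
      n * ((n : ℝ) ^ s - ((n : ℝ) - 1) ^ s) ^ t +
      (n : ℝ) ^ 2 * (((n : ℝ) ^ s - ((n : ℝ) - 1) ^ s) ^ 2 / (n : ℝ) ^ s) ^ t := by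
  set H := (n : ℝ) ^ s - ((n : ℝ) - 1) ^ s
  set Q := H ^ 2 / (n : ℝ) ^ s
  have hQ : 0 ≤ Q := by positivity
  have h : ∀ a b : Fin n, ∑ ψ : Fin t → Fin s → Fin n,
      (∏ i, hitInd a (ψ i)) * (∏ i, hitInd b (ψ i)) ≤ (if a = b then H ^ t else 0) + Q ^ t := by
    intro a b
    simp only [← Finset.prod_mul_distrib]
    rw [← Fintype.sum_pow (fun φ : Fin s → Fin n => hitInd a φ * hitInd b φ) t]
    split_ifs with hab
    · subst hab
      simp only [hitInd_mul_self, sum_hitInd]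
      have := pow_nonneg hQ t
      linarith
    · rw [zero_add]
      exact pow_le_pow_left₀
        (Finset.sum_nonneg fun φ _ => mul_nonneg (hitInd_nonneg a φ) (hitInd_nonneg b φ))
        (sum_hitInd_mul_le hn s hab) t
  calc ∑ ψ : Fin t → Fin s → Fin n, numAlwaysHit ψ ^ 2
      = ∑ a : Fin n, ∑ b : Fin n, ∑ ψ : Fin t → Fin s → Fin n,
          (∏ i, hitInd a (ψ i)) * (∏ i, hitInd b (ψ i)) := by
        simp only [numAlwaysHit, sq, Finset.sum_mul_sum]
        rw [Finset.sum_comm]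
        exact Finset.sum_congr rfl fun a _ => Finset.sum_comm
    _ ≤ ∑ a : Fin n, ∑ b : Fin n, ((if a = b then H ^ t else 0) + Q ^ t) :=
        Finset.sum_le_sum fun a _ => Finset.sum_le_sum fun b _ => h a b
    _ = n * H ^ t + (n : ℝ) ^ 2 * Q ^ t := by
        simp [Finset.sum_add_distrib]
        ring

/-- A second moment bound: a nonnegative variable with mean `μ ≥ k` and variance at most `μ`
has truncated mean at least `k / 2`. -/
lemma half_le_avg_min {ι : Type*} [Fintype ι] (Y : ι → ℝ) (hY : ∀ i, 0 ≤ Y i) {N μ k : ℝ}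
    (hN : 0 < N) (hk : 1 ≤ k) (hkμ : k ≤ μ) (h1 : ∑ i, Y i = N * μ)
    (h2 : ∑ i, Y i ^ 2 ≤ N * (μ + μ ^ 2)) :
    N * (k / 2) ≤ ∑ i, min k (Y i) := by
  have hμ : 0 < μ := by linarith
  set a := k / μ with ha
  have ha0 : 0 < a := by positivity
  have ha1 : a ≤ 1 := (div_le_one hμ).2 hkμ
  have haμ : a * μ = k := div_mul_cancel₀ k hμ.ne'
  have hpt : ∀ i, a * Y i - a ^ 2 / (4 * k) * Y i ^ 2 ≤ min k (Y i) := by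
    intro i
    have e : a ^ 2 / (4 * k) * Y i ^ 2 = (a * Y i) ^ 2 / (4 * k) := by ring
    rw [e]
    refine le_min ?_ ?_
    · rw [sub_le_iff_le_add, ← sub_le_iff_le_add', le_div_iff₀ (by positivity)]
      nlinarith [sq_nonneg (a * Y i - 2 * k)]
    · have : 0 ≤ (a * Y i) ^ 2 / (4 * k) := by positivity
      nlinarith [hY i]
  have hsum := Finset.sum_le_sum fun i (_ : i ∈ Finset.univ) => hpt i
  rw [Finset.sum_sub_distrib, ← Finset.mul_sum, ← Finset.mul_sum, h1] at hsum
  refine le_trans ?_ hsum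
  have h3 : a ^ 2 / (4 * k) * ∑ i, Y i ^ 2 ≤ a ^ 2 / (4 * k) * (N * (μ + μ ^ 2)) :=
    mul_le_mul_of_nonneg_left h2 (by positivity)
  have h4 : a ^ 2 / (4 * k) * (N * (μ + μ ^ 2)) = N * (a / 4 + k / 4) := by
    have : a ^ 2 * (μ + μ ^ 2) = k * (a + k) := by rw [← haμ]; ring
    calc a ^ 2 / (4 * k) * (N * (μ + μ ^ 2)) = N * (a ^ 2 * (μ + μ ^ 2)) / (4 * k) := by ring
      _ = _ := by rw [this]; field_simp
  have h5 : a * (N * μ) = N * k := by rw [← haμ]; ring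
  rw [h5]
  nlinarith

/-- The top `k` bins contain at least `t` balls for each of `min k Y` bins, where `Y` is the number
of bins that are hit in each of `t` disjoint rounds. -/
lemma mul_min_le_ballsInTopBins {n k t s : ℕ} (hk : k ≤ n) (e : Fin t × Fin s ↪ Fin n)
    (ω : Fin n → Fin n) :
    (t : ℝ) * min (k : ℝ) (numAlwaysHit fun i j => ω (e (i, j))) ≤ ballsInTopBins n k ω := by
  classical
  set S : Finset (Fin n) := Finset.univ.filter fun b => ∀ i, ∃ j, ω (e (i, j)) = b with hS
  have hY : (numAlwaysHit fun i j => ω (e (i, j))) = (#S : ℝ) := by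
    simp only [numAlwaysHit, hitInd_eq_ite, hS, Finset.prod_ite_zero]
    simp
  have hload : ∀ b ∈ S, t ≤ #(Finset.univ.filter fun i => ω i = b) := by
    intro b hb
    rw [hS, Finset.mem_filter] at hb
    choose j hj using hb.2
    have := Finset.card_le_card_of_injOn (s := (Finset.univ : Finset (Fin t)))
      (t := Finset.univ.filter fun i => ω i = b) (fun i => e (i, j i))
      (fun i _ => by simp [hj]) (fun i _ i' _ h => (Prod.ext_iff.1 (e.injective h)).1)
    simpa using this
  obtain ⟨U, hUS, hU⟩ := Finset.exists_subset_card_eq (min_le_right k #S)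
  obtain ⟨T, hUT, -, hT⟩ := Finset.exists_subsuperset_card_eq (Finset.subset_univ U)
    (hU.trans_le (min_le_left k #S)) (by simpa using hk)
  have key : t * min k #S ≤ ballsInTopBins n k ω := by
    calc t * min k #S = ∑ _b ∈ U, t := by simp [hU, mul_comm]
      _ ≤ ∑ b ∈ U, #(Finset.univ.filter fun i => ω i = b) :=
          Finset.sum_le_sum fun b hb => hload b (hUS hb)
      _ ≤ ∑ b ∈ T, #(Finset.univ.filter fun i => ω i = b) := Finset.sum_le_sum_of_subset hUT
      _ ≤ ballsInTopBins n k ω :=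
          Finset.le_sup (f := fun T => ∑ b ∈ T, #(Finset.univ.filter fun i => ω i = b))
            (Finset.mem_powersetCard.2 ⟨Finset.subset_univ T, hT⟩)
  rw [hY]
  exact_mod_cast key

/-- The first `t * s` balls of a uniform throw of `n` balls form `t` uniform rounds of `s` balls. -/
lemma exists_rounds {n t s : ℕ} (h : t * s ≤ n) :
    ∃ e : Fin t × Fin s ↪ Fin n, ∀ G : (Fin t → Fin s → Fin n) → ℝ,
      ∑ ω : Fin n → Fin n, G (fun i j => ω (e (i, j))) =
        (n : ℝ) ^ (n - t * s) * ∑ ψ, G ψ := by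
  let f : (Fin t × Fin s) ⊕ Fin (n - t * s) ≃ Fin n :=
    ((Equiv.sumCongr finProdFinEquiv (Equiv.refl _)).trans finSumFinEquiv).trans
      (finCongr (by omega))
  refine ⟨⟨fun p => f (Sum.inl p), fun p q hpq => Sum.inl_injective (f.injective hpq)⟩, ?_⟩
  intro G
  let g : (Fin n → Fin n) ≃ (Fin t → Fin s → Fin n) × (Fin (n - t * s) → Fin n) :=
    ((Equiv.arrowCongr f.symm (Equiv.refl (Fin n))).trans
      (Equiv.sumArrowEquivProdArrow _ _ _)).trans
      (Equiv.prodCongr (Equiv.curry _ _ _) (Equiv.refl _))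
  calc ∑ ω : Fin n → Fin n, G (fun i j => ω (f (Sum.inl (i, j))))
      = ∑ ω : Fin n → Fin n, G (g ω).1 := rfl
    _ = ∑ p : (Fin t → Fin s → Fin n) × (Fin (n - t * s) → Fin n), G p.1 :=
        Equiv.sum_comp g fun p => G p.1
    _ = _ := by
        rw [Fintype.sum_prod_type]
        simp [Finset.mul_sum]

lemma inv_le_hit_prob {n t s : ℕ} (ht : 0 < t) (htn : t ≤ n) (hs : s = n / t) :
    1 / (4 * (t : ℝ)) ≤ ((n : ℝ) ^ s - ((n : ℝ) - 1) ^ s) / (n : ℝ) ^ s := by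
  have hn : (1 : ℝ) ≤ n := by exact_mod_cast ht.trans_le htn
  have ht' : (0 : ℝ) < t := by exact_mod_cast ht
  have hs1 : 1 ≤ s := hs ▸ (Nat.one_le_div_iff ht).2 htn
  have hsn : (s : ℝ) ≤ n := by exact_mod_cast hs ▸ Nat.div_le_self n t
  have hst : (n : ℝ) ≤ 2 * t * s := by
    have h1 : n < t * (s + 1) := hs ▸ Nat.lt_mul_div_succ n ht
    have : n ≤ 2 * t * s := by nlinarith
    exact_mod_cast this
  set x : ℝ := s / n with hx
  have hx0 : 0 ≤ x := by positivity
  have hx1 : x ≤ 1 := (div_le_one (by linarith)).2 hsn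
  have hxt : 1 / (2 * (t : ℝ)) ≤ x := by
    rw [hx, div_le_div_iff₀ (by positivity) (by linarith)]
    linarith
  set q : ℝ := (((n : ℝ) - 1) / n) ^ s with hq
  have hq0 : 0 ≤ q := pow_nonneg (div_nonneg (by linarith) (by linarith)) s
  have hbern : 1 + x ≤ (1 + 1 / (n : ℝ)) ^ s := by
    have := one_add_mul_le_pow (a := 1 / (n : ℝ))
      (le_trans (by norm_num) (by positivity : (0 : ℝ) ≤ 1 / n)) s
    rwa [mul_one_div] at this
  have hqx : q * (1 + x) ≤ 1 := by
    refine (mul_le_mul_of_nonneg_left hbern hq0).trans ?_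
    rw [hq, ← mul_pow]
    have hb : ((n : ℝ) - 1) / n * (1 + 1 / n) = 1 - (1 / (n : ℝ)) ^ 2 := by
      field_simp
      ring
    rw [hb]
    refine pow_le_one₀ ?_ (by nlinarith [sq_nonneg (1 / (n : ℝ))])
    have : 1 / (n : ℝ) ≤ 1 := (div_le_one (by linarith)).2 hn
    have h0 : 0 ≤ 1 / (n : ℝ) := by positivity
    nlinarith
  rw [sub_div, div_self (by positivity), ← div_pow, ← hq]
  have e : 1 / (4 * (t : ℝ)) = 1 / (2 * (t : ℝ)) / 2 := by field_simp; norm_num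
  rw [e]
  nlinarith

/-- If `(4t)^t ≤ n / k`, the top `k` bins contain at least `t * k / 2` balls on average. -/
lemma half_mul_le_avg_ballsInTopBins {n k t : ℕ} (hn : 2 ≤ n) (hk : 0 < k) (ht : 0 < t)
    (h : (k : ℝ) * (4 * t) ^ t ≤ n) :
    (t : ℝ) * (k / 2) ≤ (∑ ω : Fin n → Fin n, (ballsInTopBins n k ω : ℝ)) / (n : ℝ) ^ n := by
  have ht1 : (1 : ℝ) ≤ t := by exact_mod_cast ht
  have hk1 : (1 : ℝ) ≤ k := by exact_mod_cast hk
  have hn0 : (0 : ℝ) < n := by exact_mod_cast (by omega : 0 < n)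
  have hpow : 4 * (t : ℝ) ≤ (4 * t) ^ t := le_self_pow₀ (by linarith) ht.ne'
  have htn : t ≤ n := by
    have : (t : ℝ) ≤ n := by nlinarith
    exact_mod_cast this
  have hkn : k ≤ n := by
    have : (k : ℝ) ≤ n := by nlinarith
    exact_mod_cast this
  obtain ⟨s, hs⟩ : ∃ s, s = n / t := ⟨_, rfl⟩
  have hts : t * s ≤ n := hs ▸ Nat.mul_div_le n t
  obtain ⟨e, he⟩ := exists_rounds (n := n) hts
  have hp := inv_le_hit_prob ht htn hs
  have h1 := sum_numAlwaysHit n t s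
  have h2 := sum_numAlwaysHit_sq_le hn t s
  set H := (n : ℝ) ^ s - ((n : ℝ) - 1) ^ s
  set D := (n : ℝ) ^ s with hD
  have hD0 : 0 < D := by positivity
  have hμ : (k : ℝ) ≤ n * (H / D) ^ t := by
    calc (k : ℝ) ≤ n * (1 / (4 * (t : ℝ))) ^ t := by
          rw [div_pow, one_pow, mul_one_div, le_div_iff₀ (by positivity)]
          exact h
      _ ≤ _ := by gcongr
  have hmin := half_le_avg_min (N := D ^ t) (μ := n * (H / D) ^ t) (k := k)
    (fun ψ : Fin t → Fin s → Fin n => numAlwaysHit ψ)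
    (fun ψ => Finset.sum_nonneg fun b _ => Finset.prod_nonneg fun i _ => hitInd_nonneg b _)
    (by positivity) hk1 hμ
    (by rw [h1, div_pow]; field_simp)
    (h2.trans_eq (by rw [div_pow, div_pow, pow_right_comm H 2 t]; field_simp))
  have hnn : (n : ℝ) ^ n = (n : ℝ) ^ (n - t * s) * D ^ t := by
    rw [hD, ← pow_mul, ← pow_add]
    congr 1
    rw [mul_comm s t]
    omega
  rw [le_div_iff₀ (by positivity), hnn]
  calc (t : ℝ) * (k / 2) * ((n : ℝ) ^ (n - t * s) * D ^ t)
      = t * ((n : ℝ) ^ (n - t * s) * (D ^ t * (k / 2))) := by ring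
    _ ≤ t * ((n : ℝ) ^ (n - t * s) *
          ∑ ψ : Fin t → Fin s → Fin n, min (k : ℝ) (numAlwaysHit ψ)) := by gcongr
    _ = ∑ ω : Fin n → Fin n, t * min (k : ℝ) (numAlwaysHit fun i j => ω (e (i, j))) := by
        rw [← he fun ψ => min (k : ℝ) (numAlwaysHit ψ), Finset.mul_sum]
    _ ≤ _ := Finset.sum_le_sum fun ω _ => mul_min_le_ballsInTopBins hkn e ω

/-- There exist constants `C₀, c > 0` such that if `n` balls are thrown i.i.d.
uniformly into `n` bins, then for every `k ≤ C₀·n` the expected number of balls in the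
`k` most loaded bins is at least `c · k · log(n/k) / log log (n/k)`. -/
theorem stmt_1 :
    ∃ C₀ > (0 : ℝ), ∃ c > (0 : ℝ), ∀ n k : ℕ, 0 < k → (k : ℝ) ≤ C₀ * n →
      c * k * Real.log ((n : ℝ) / k) / Real.log (Real.log ((n : ℝ) / k)) ≤
        (∑ ω : Fin n → Fin n, (ballsInTopBins n k ω : ℝ)) / (n : ℝ) ^ n := by
  refine ⟨(Real.exp (Real.exp 4))⁻¹, by positivity, 1 / 4, by norm_num, ?_⟩
  intro n k hk hkn
  have hk1 : (1 : ℝ) ≤ k := by exact_mod_cast hk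
  rw [inv_mul_eq_div, le_div_iff₀ (Real.exp_pos _)] at hkn
  have hx : Real.exp (Real.exp 4) ≤ (n : ℝ) / k := by
    rw [le_div_iff₀ (by linarith)]
    linarith
  have hx0 : 0 < (n : ℝ) / k := (Real.exp_pos _).trans_le hx
  have hL : Real.exp 4 ≤ Real.log ((n : ℝ) / k) := (Real.le_log_iff_exp_le hx0).2 hx
  have hL0 : 0 < Real.log ((n : ℝ) / k) := (Real.exp_pos _).trans_le hL
  have hl : 4 ≤ Real.log (Real.log ((n : ℝ) / k)) := (Real.le_log_iff_exp_le hL0).2 hL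
  have hn : 2 ≤ n := by
    have h1 : (2 : ℝ) ≤ Real.exp (Real.exp 4) := by
      have := Real.add_one_le_exp (Real.exp 4)
      have := Real.add_one_le_exp (4 : ℝ)
      linarith
    have : (2 : ℝ) ≤ n := by nlinarith
    exact_mod_cast this
  set L := Real.log ((n : ℝ) / k) with hLdef
  set l := Real.log L with hldef
  have hlL : l ≤ L := (Real.log_le_sub_one_of_pos hL0).trans (by linarith)
  have hr : 1 ≤ L / l := (one_le_div (by linarith)).2 hlL
  obtain ⟨t, ht⟩ : ∃ t, t = ⌊L / l⌋₊ := ⟨_, rfl⟩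
  have ht0 : 0 < t := ht ▸ Nat.floor_pos.2 hr
  have ht1 : (1 : ℝ) ≤ t := by exact_mod_cast ht0
  have htle : (t : ℝ) ≤ L / l := ht ▸ Nat.floor_le (by linarith)
  have htge : L / l < t + 1 := ht ▸ Nat.lt_floor_add_one _
  have htl : (t : ℝ) * l ≤ L := (le_div_iff₀ (by linarith)).1 htle
  have h4t : 4 * (t : ℝ) ≤ L := by nlinarith
  have hpow : (4 * (t : ℝ)) ^ t ≤ (n : ℝ) / k := by
    rw [← Real.log_le_log_iff (by positivity) hx0, Real.log_pow]
    have : Real.log (4 * (t : ℝ)) ≤ l := Real.log_le_log (by linarith) h4t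
    nlinarith
  rw [le_div_iff₀ (by linarith)] at hpow
  refine le_trans ?_ (half_mul_le_avg_ballsInTopBins hn hk ht0 (by linarith))
  rw [mul_div_assoc]
  nlinarith
end

section
/- For a nonnegative function f of n bin-load variables such that m ↦ E[f(X_1^m, ..., X_n^m)] is monotone (increasing or decreasing) in the number of balls m, the expectation under the exact balls-in-bins load distribution with m balls is at most twice the expectation when the loads are replaced by n independent Poisson(m/n) random variables. -/
open Finset

/-- The load of bin `b` when the `m` balls are placed according to `ω : Fin m → Fin n`. -/
def binLoad (n m : ℕ) (ω : Fin m → Fin n) (b : Fin n) : ℕ :=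
  (Finset.univ.filter (fun i => ω i = b)).card

/-- The expectation of `f` applied to the loads of the `n` bins when `m` balls are
thrown i.i.d. uniformly at random into the `n` bins. -/
noncomputable def ballsExp (n m : ℕ) (f : (Fin n → ℕ) → ENNReal) : ENNReal :=
  (∑ ω : Fin m → Fin n, f (binLoad n m ω)) / (n : ENNReal) ^ m

/-- The expectation of `f` applied to `n` independent `Poisson(m/n)` random variables. -/
noncomputable def poissonExp (n m : ℕ) (f : (Fin n → ℕ) → ENNReal) : ENNReal :=
  ∑' y : Fin n → ℕ,
    (∏ i : Fin n,
      ENNReal.ofReal (ProbabilityTheory.poissonPMFReal ((m : NNReal) / n) (y i))) * f y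

open scoped Nat

set_option linter.deprecated false

theorem binLoad_cons {n k : ℕ} (b : Fin n) (ω : Fin k → Fin n) :
    binLoad n (k + 1) (Fin.cons b ω) = binLoad n k ω + Pi.single b 1 := by
  funext c
  simp only [binLoad, Fin.card_filter_univ_succ', Fin.cons_zero, Fin.cons_succ, Pi.add_apply,
    Pi.single_apply]
  rw [add_comm]
  congr 1
  simp [eq_comm]

theorem sum_binLoad {n k : ℕ} (ω : Fin k → Fin n) : ∑ b, binLoad n k ω b = k := by
  simp only [binLoad]
  rw [← Finset.card_eq_sum_card_fiberwise (fun _ _ => Finset.mem_coe.2 (Finset.mem_univ _))]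
  simp

theorem card_binLoad_eq_succ {n k : ℕ} (y : Fin n → ℕ) :
    #{ω : Fin (k + 1) → Fin n | binLoad n (k + 1) ω = y} =
      ∑ b, #{ω : Fin k → Fin n | binLoad n k ω + Pi.single b 1 = y} := by
  simp only [Finset.card_filter]
  rw [← (Fin.consEquiv fun _ => Fin n).sum_comp, Fintype.sum_prod_type]
  simp [Fin.consEquiv, binLoad_cons]

/-- The number of placements with given loads is the multinomial coefficient. -/
theorem prod_factorial_mul_card_binLoad_eq {n k : ℕ} (y : Fin n → ℕ) (hy : ∑ b, y b = k) :
    (∏ b, (y b)!) * #{ω : Fin k → Fin n | binLoad n k ω = y} = k ! := by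
  induction k generalizing y with
  | zero =>
    have hy0 : y = 0 := by
      funext b
      simpa using Finset.sum_eq_zero_iff.1 hy b (Finset.mem_univ b)
    subst hy0
    have h : ∀ ω : Fin 0 → Fin n, binLoad n 0 ω = 0 := fun ω => by
      funext b
      simp [binLoad]
    simp [h]
  | succ k ih =>
    rw [card_binLoad_eq_succ, Finset.mul_sum, Nat.factorial_succ, ← hy, Finset.sum_mul]
    refine Finset.sum_congr rfl fun b _ => ?_
    by_cases hb : y b = 0
    · have h : ∀ ω : Fin k → Fin n, binLoad n k ω + Pi.single b 1 ≠ y := fun ω h => by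
        have := congrFun h b
        simp [hb] at this
      simp [h, hb]
    · obtain ⟨z, rfl⟩ : ∃ z : Fin n → ℕ, y = z + Pi.single b 1 := by
        refine ⟨y - Pi.single b 1, funext fun c => ?_⟩
        by_cases hc : c = b
        · subst hc
          simp; omega
        · simp [hc]
      have hz : ∑ c, z c = k := by
        simpa [Finset.sum_add_distrib] using hy
      have hprod : ∏ c, ((z + Pi.single b 1 : Fin n → ℕ) c)! =
          (z + Pi.single b 1 : Fin n → ℕ) b * ∏ c, (z c)! := by
        rw [← Finset.mul_prod_erase _ _ (Finset.mem_univ b),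
          ← Finset.mul_prod_erase _ (fun c => (z c)!) (Finset.mem_univ b), ← mul_assoc]
        congr 1
        · simp [Nat.factorial_succ]
        · refine Finset.prod_congr rfl fun c hc => ?_
          simp [Finset.ne_of_mem_erase hc]
      simp only [add_left_inj, hprod]
      rw [mul_assoc, ih z hz]

theorem prod_poissonPMFReal {n : ℕ} (hn : 0 < n) (m : ℕ) (y : Fin n → ℕ) :
    ∏ i, ProbabilityTheory.poissonPMFReal ((m : NNReal) / n) (y i) =
      ProbabilityTheory.poissonPMFReal m (∑ i, y i) / (n : ℝ) ^ (∑ i, y i) *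
        #{ω : Fin (∑ i, y i) → Fin n | binLoad n (∑ i, y i) ω = y} := by
  have hn' : (n : ℝ) ≠ 0 := by positivity
  have hcard : (∏ b, ((y b)! : ℝ)) *
      #{ω : Fin (∑ i, y i) → Fin n | binLoad n (∑ i, y i) ω = y} = (∑ i, y i)! := by
    exact_mod_cast prod_factorial_mul_card_binLoad_eq y rfl
  have hprod : (∏ b, ((y b)! : ℝ)) ≠ 0 :=
    Finset.prod_ne_zero_iff.2 fun b _ => by positivity
  have hexp : Real.exp (-(m / n : ℝ)) ^ n = Real.exp (-m) := by
    rw [← Real.exp_nat_mul]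
    congr 1
    field_simp
  simp only [ProbabilityTheory.poissonPMFReal, Finset.prod_div_distrib, Finset.prod_mul_distrib,
    Finset.prod_pow_eq_pow_sum, NNReal.coe_div, NNReal.coe_natCast, Finset.prod_const,
    Finset.card_univ, Fintype.card_fin, hexp]
  rw [← hcard, div_pow]
  have hcard0 : (#{ω : Fin (∑ i, y i) → Fin n | binLoad n (∑ i, y i) ω = y} : ℝ) ≠ 0 := by
    intro h
    rw [h, mul_zero] at hcard
    exact (Nat.cast_ne_zero.2 (Nat.factorial_ne_zero _)) hcard.symm
  field_simp

/-- Conditioning on the total number of balls: the Poisson expectation is the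
`Poisson(m)`-mixture of the balls-in-bins expectations. -/
theorem poissonExp_eq_tsum_ballsExp {n : ℕ} (hn : 0 < n) (m : ℕ) (f : (Fin n → ℕ) → ENNReal) :
    poissonExp n m f =
      ∑' k, ENNReal.ofReal (ProbabilityTheory.poissonPMFReal m k) * ballsExp n k f := by
  have hballs : ∀ k, ballsExp n k f =
      ∑' y, (#{ω : Fin k → Fin n | binLoad n k ω = y} : ENNReal) / (n : ENNReal) ^ k * f y := by
    intro k
    have h : ∀ ω : Fin k → Fin n,
        f (binLoad n k ω) = ∑' y, if binLoad n k ω = y then f y else 0 := fun ω => by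
      rw [tsum_eq_single (binLoad n k ω) (fun y hy => if_neg hy.symm), if_pos rfl]
    simp only [ballsExp, h]
    rw [← Summable.tsum_finsetSum fun _ _ => ENNReal.summable, div_eq_mul_inv,
      ← ENNReal.tsum_mul_right]
    refine tsum_congr fun y => ?_
    rw [← Finset.sum_filter, Finset.sum_const, nsmul_eq_mul, div_eq_mul_inv]
    ring
  simp only [hballs, poissonExp, ← ENNReal.tsum_mul_left]
  rw [ENNReal.tsum_comm]
  refine tsum_congr fun y => ?_
  rw [tsum_eq_single (∑ i, y i)]
  · have hpos : (0 : ℝ) < (n : ℝ) ^ (∑ i, y i) := by positivity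
    rw [← ENNReal.ofReal_prod_of_nonneg
      fun _ _ => ProbabilityTheory.poissonPMFReal_nonneg, prod_poissonPMFReal hn,
      ENNReal.ofReal_mul (div_nonneg ProbabilityTheory.poissonPMFReal_nonneg hpos.le),
      ENNReal.ofReal_div_of_pos hpos, ENNReal.ofReal_pow (by positivity),
      ENNReal.ofReal_natCast, ENNReal.ofReal_natCast]
    simp only [div_eq_mul_inv]
    ring
  · intro k hk
    have h : ∀ ω : Fin k → Fin n, binLoad n k ω ≠ y := by
      rintro ω rfl
      exact hk (sum_binLoad ω).symm
    simp [h]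

theorem hasDerivAt_exp_neg_mul_sum_pow_div_factorial (m : ℕ) (x : ℝ) :
    HasDerivAt (fun x : ℝ => ∑ k ∈ range (m + 1), Real.exp (-x) * x ^ k / k !)
      (-(Real.exp (-x) * x ^ m / m !)) x := by
  have hexp : HasDerivAt (fun x : ℝ => Real.exp (-x)) (-Real.exp (-x)) x := by
    simpa using (hasDerivAt_neg x).exp
  induction m with
  | zero => simpa using hexp
  | succ m ih =>
    simp only [Finset.sum_range_succ _ (m + 1)]
    convert! ih.add ((hexp.mul (hasDerivAt_pow (m + 1) x)).div_const ((m + 1)! : ℝ)) using 1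
    rw [Nat.factorial_succ]
    push_cast
    field_simp
    ring

theorem one_sub_mul_exp_le_one_add_mul_exp_neg {u : ℝ} (hu : 0 ≤ u) :
    (1 - u) * Real.exp u ≤ (1 + u) * Real.exp (-u) := by
  have hderiv : ∀ x : ℝ, HasDerivAt
      (fun x : ℝ => (1 + x) * Real.exp (-x) - (1 - x) * Real.exp x)
      (x * (Real.exp x - Real.exp (-x))) x := by
    intro x
    have h1 := ((hasDerivAt_id x).const_add 1).mul (hasDerivAt_neg x).exp
    have h2 := ((hasDerivAt_id x).const_sub 1).mul (Real.hasDerivAt_exp x)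
    convert! h1.sub h2 using 1
    simp only [id]
    ring
  have hmono := monotoneOn_of_deriv_nonneg (convex_Ici (0 : ℝ))
    (fun x _ => (hderiv x).continuousAt.continuousWithinAt)
    (fun x _ => (hderiv x).differentiableAt.differentiableWithinAt) fun x hx => by
      rw [interior_Ici] at hx
      rw [(hderiv x).deriv]
      exact mul_nonneg hx.le (sub_nonneg.2 (Real.exp_le_exp.2 (by linarith [Set.mem_Ioi.1 hx])))
  have := hmono Set.self_mem_Ici hu hu
  simpa using this

theorem exp_neg_mul_pow_sub_le_add {m : ℕ} {t : ℝ} (ht : 0 ≤ t) (htm : t ≤ m) :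
    Real.exp (-(m - t)) * (m - t) ^ m ≤ Real.exp (-(m + t)) * (m + t) ^ m := by
  rcases Nat.eq_zero_or_pos m with rfl | hm
  · obtain rfl : t = 0 := le_antisymm (by simpa using htm) ht
    simp
  have hm' : (0 : ℝ) < m := by exact_mod_cast hm
  have hu : t / m ≤ 1 := (div_le_one hm').2 htm
  have h := pow_le_pow_left₀ (mul_nonneg (sub_nonneg.2 hu) (Real.exp_pos _).le)
    (one_sub_mul_exp_le_one_add_mul_exp_neg (div_nonneg ht hm'.le)) m
  rw [mul_pow, mul_pow, ← Real.exp_nat_mul, ← Real.exp_nat_mul] at h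
  have h1 : (m : ℝ) * (t / m) = t := by field_simp
  rw [mul_neg, h1] at h
  have h2 : (m - t : ℝ) = m * (1 - t / m) := by field_simp
  have h3 : (m + t : ℝ) = m * (1 + t / m) := by field_simp
  calc Real.exp (-(m - t)) * (m - t) ^ m
      = Real.exp (-m) * m ^ m * ((1 - t / m) ^ m * Real.exp t) := by
        rw [show -((m : ℝ) - t) = -m + t by ring, Real.exp_add, h2, mul_pow]
        ring
    _ ≤ Real.exp (-m) * m ^ m * ((1 + t / m) ^ m * Real.exp (-t)) := by gcongr
    _ = Real.exp (-(m + t)) * (m + t) ^ m := by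
        rw [show -((m : ℝ) + t) = -m + -t by ring, Real.exp_add, h3, mul_pow]
        ring

/-- A Poisson variable with integer mean `m` is at most `m` with probability at least `1/2`. -/
theorem one_le_two_mul_sum_range_succ_poissonPMFReal (m : ℕ) :
    1 ≤ 2 * ∑ k ∈ range (m + 1), ProbabilityTheory.poissonPMFReal m k := by
  set S : ℝ → ℝ := fun x => ∑ k ∈ range (m + 1), Real.exp (-x) * x ^ k / k ! with hS
  have hderiv : ∀ t : ℝ, HasDerivAt (fun t => S (m - t) + S (m + t))
      (Real.exp (-(m - t)) * (m - t) ^ m / (m ! : ℝ) - Real.exp (-(m + t)) * (m + t) ^ m / (m ! : ℝ)) t := by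
    intro t
    have h1 := (hasDerivAt_exp_neg_mul_sum_pow_div_factorial m (m - t)).comp t
      ((hasDerivAt_id t).const_sub (m : ℝ))
    have h2 := (hasDerivAt_exp_neg_mul_sum_pow_div_factorial m (m + t)).comp t
      ((hasDerivAt_id t).const_add (m : ℝ))
    convert! h1.add h2 using 1
    ring
  have hanti := antitoneOn_of_deriv_nonpos (convex_Icc (0 : ℝ) m)
    (fun t _ => (hderiv t).continuousAt.continuousWithinAt)
    (fun t _ => (hderiv t).differentiableAt.differentiableWithinAt) fun t ht => by
      rw [interior_Icc] at ht
      rw [(hderiv t).deriv, sub_nonpos]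
      gcongr ?_ / _
      exact exp_neg_mul_pow_sub_le_add ht.1.le ht.2.le
  have hm : (0 : ℝ) ≤ m := Nat.cast_nonneg m
  have h := hanti (Set.left_mem_Icc.2 hm) (Set.right_mem_Icc.2 hm) hm
  have hS0 : S 0 = 1 := by
    simp [hS, Finset.sum_range_succ']
  have hSnonneg : 0 ≤ S (m + m) := Finset.sum_nonneg fun k _ => by positivity
  have hSm : S m = ∑ k ∈ range (m + 1), ProbabilityTheory.poissonPMFReal m k := by
    simp [hS, ProbabilityTheory.poissonPMFReal]
  simp only [sub_self, sub_zero, add_zero, hS0] at h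
  rw [← hSm]
  linarith

theorem poissonPMFReal_le_reflect {m h : ℕ} (hh : h < m) :
    ProbabilityTheory.poissonPMFReal m (m - 1 - h) ≤
      ProbabilityTheory.poissonPMFReal m (m + h) := by
  have key : ∀ h a : ℕ, (a + 2 * h + 1)! ≤ a ! * (a + h + 1) ^ (2 * h + 1) := by
    intro h
    induction h with
    | zero => intro a; simp [Nat.factorial_succ, mul_comm]
    | succ h ih =>
      intro a
      have := ih (a + 1)
      rw [show a + 2 * (h + 1) + 1 = (a + 1 + 2 * h + 1) + 1 by ring, Nat.factorial_succ]
      calc (a + 1 + 2 * h + 1 + 1) * (a + 1 + 2 * h + 1)!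
          ≤ (a + 1 + 2 * h + 1 + 1) * ((a + 1)! * (a + 1 + h + 1) ^ (2 * h + 1)) := by gcongr
        _ = ((a + 1 + 2 * h + 1 + 1) * (a + 1)) * (a ! * (a + 1 + h + 1) ^ (2 * h + 1)) := by
            rw [Nat.factorial_succ]; ring
        _ ≤ (a + (h + 1) + 1) ^ 2 * (a ! * (a + 1 + h + 1) ^ (2 * h + 1)) := by
            gcongr
            nlinarith
        _ = a ! * (a + (h + 1) + 1) ^ (2 * (h + 1) + 1) := by
            rw [show a + 1 + h + 1 = a + (h + 1) + 1 by ring]; ring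
  obtain ⟨a, rfl⟩ : ∃ a, m = a + h + 1 := ⟨m - 1 - h, by omega⟩
  rw [show a + h + 1 - 1 - h = a by omega, show a + h + 1 + h = a + (2 * h + 1) by ring]
  simp only [ProbabilityTheory.poissonPMFReal, NNReal.coe_natCast]
  rw [div_le_div_iff₀ (by positivity) (by positivity), pow_add]
  have h2 : ((a + (2 * h + 1))! : ℝ) ≤ a ! * ((a + h + 1 : ℕ) : ℝ) ^ (2 * h + 1) := by
    exact_mod_cast key h a
  calc _ ≤ Real.exp (-((a + h + 1 : ℕ) : ℝ)) * ((a + h + 1 : ℕ) : ℝ) ^ a *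
        (a ! * ((a + h + 1 : ℕ) : ℝ) ^ (2 * h + 1)) := by gcongr
    _ = _ := by ring

/-- A Poisson variable with integer mean `m` is at least `m` with probability at least `1/2`. -/
theorem one_le_two_mul_tsum_poissonPMFReal (m : ℕ) :
    1 ≤ 2 * ∑' k, ProbabilityTheory.poissonPMFReal m (k + m) := by
  have hsum : HasSum (fun k => ProbabilityTheory.poissonPMFReal m k) 1 :=
    ProbabilityTheory.poissonPMFRealSum m
  have hsplit := hsum.summable.sum_add_tsum_nat_add m
  have hle : ∑ k ∈ range m, ProbabilityTheory.poissonPMFReal m k ≤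
      ∑' k, ProbabilityTheory.poissonPMFReal m (k + m) := by
    rw [← Finset.sum_range_reflect]
    calc _ ≤ ∑ k ∈ range m, ProbabilityTheory.poissonPMFReal m (k + m) :=
          Finset.sum_le_sum fun k hk => by
            rw [add_comm k m]
            exact poissonPMFReal_le_reflect (Finset.mem_range.1 hk)
      _ ≤ _ := ((summable_nat_add_iff m).2 hsum.summable).sum_le_tsum _
          fun _ _ => ProbabilityTheory.poissonPMFReal_nonneg
  rw [hsum.tsum_eq] at hsplit
  linarith

/-- Poisson approximation: for a nonnegative function `f` of the `n` bin loads such that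
`m ↦ E[f(X₁^m, …, Xₙ^m)]` is monotone in the number of balls `m`, the expectation under
the exact balls-in-bins distribution with `m` balls is at most twice the expectation when
the loads are replaced by `n` independent `Poisson(m/n)` variables. -/
theorem stmt_3 (n m : ℕ) (hn : 0 < n) (f : (Fin n → ℕ) → ENNReal)
    (hmono : Monotone (fun m' => ballsExp n m' f) ∨ Antitone (fun m' => ballsExp n m' f)) :
    ballsExp n m f ≤ 2 * poissonExp n m f := by
  rw [poissonExp_eq_tsum_ballsExp hn]
  have hp : ∀ k, 0 ≤ ProbabilityTheory.poissonPMFReal m k :=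
    fun _ => ProbabilityTheory.poissonPMFReal_nonneg
  rcases hmono with hmono | hanti
  · have hsummable : Summable fun k => ProbabilityTheory.poissonPMFReal m (k + m) :=
      (summable_nat_add_iff m).2 (ProbabilityTheory.poissonPMFRealSum m).summable
    have hmass : 1 ≤ 2 * ∑' k, ENNReal.ofReal (ProbabilityTheory.poissonPMFReal m (k + m)) := by
      rw [← ENNReal.ofReal_tsum_of_nonneg (fun k => hp _) hsummable]
      simpa [ENNReal.ofReal_mul] using
        ENNReal.ofReal_le_ofReal (one_le_two_mul_tsum_poissonPMFReal m)
    calc ballsExp n m f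
        ≤ (2 * ∑' k, ENNReal.ofReal (ProbabilityTheory.poissonPMFReal m (k + m))) *
            ballsExp n m f := le_mul_of_one_le_left' hmass
      _ = 2 * ∑' k, ENNReal.ofReal (ProbabilityTheory.poissonPMFReal m (k + m)) *
            ballsExp n m f := by rw [mul_assoc, ENNReal.tsum_mul_right]
      _ ≤ 2 * ∑' k, ENNReal.ofReal (ProbabilityTheory.poissonPMFReal m (k + m)) *
            ballsExp n (k + m) f := by
          gcongr with k
          exact hmono (Nat.le_add_left m k)
      _ ≤ _ := by
          gcongr 2 * ?_
          exact ENNReal.tsum_comp_le_tsum_of_injective (add_left_injective m)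
            fun k => ENNReal.ofReal (ProbabilityTheory.poissonPMFReal m k) * ballsExp n k f
  · have hmass : 1 ≤ 2 * ∑ k ∈ range (m + 1),
        ENNReal.ofReal (ProbabilityTheory.poissonPMFReal m k) := by
      rw [← ENNReal.ofReal_sum_of_nonneg fun k _ => hp k]
      simpa [ENNReal.ofReal_mul] using
        ENNReal.ofReal_le_ofReal (one_le_two_mul_sum_range_succ_poissonPMFReal m)
    calc ballsExp n m f
        ≤ (2 * ∑ k ∈ range (m + 1), ENNReal.ofReal (ProbabilityTheory.poissonPMFReal m k)) *
            ballsExp n m f := le_mul_of_one_le_left' hmass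
      _ = 2 * ∑ k ∈ range (m + 1), ENNReal.ofReal (ProbabilityTheory.poissonPMFReal m k) *
            ballsExp n m f := by rw [mul_assoc, Finset.sum_mul]
      _ ≤ 2 * ∑ k ∈ range (m + 1), ENNReal.ofReal (ProbabilityTheory.poissonPMFReal m k) *
            ballsExp n k f := by
          gcongr with k hk
          exact hanti (Nat.lt_succ_iff.1 (Finset.mem_range.1 hk))
      _ ≤ _ := by
          gcongr 2 * ?_
          exact ENNReal.sum_le_tsum _
end

section
/- In a tree metric with n leaves (servers at leaves) with i.i.d. uniform requests, the expected optimal perfect matching cost satisfies E[OPT] ≥ (1/2)·∑_{e} d_e·√(n_e), where n_e is the number of leaves on the smaller side of edge e. -/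
open Finset
open scoped Classical

/-- The leaves (degree-1 vertices) of a graph `G`, where the servers sit. -/
noncomputable def leaves {V : Type*} [Fintype V] (G : SimpleGraph V) : Finset V :=
  Finset.univ.filter (fun v => G.degree v = 1)

/-- The tree distance between `u` and `v`: the total `w`-length of the unique path. -/
noncomputable def treeDist {V : Type*} {G : SimpleGraph V} (hG : G.IsTree)
    (w : Sym2 V → ℝ) (u v : V) : ℝ :=
  (((hG.existsUnique_path u v).exists.choose.edges).map w).sum

/-- The number of leaves on the smaller side of the edge `e`: deleting `e` splits the
tree into two components, and we count the leaves in the smaller one. -/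
noncomputable def smallSideLeaves {V : Type*} [Fintype V] (G : SimpleGraph V)
    (e : Sym2 V) : ℕ :=
  min (((leaves G).filter
        (fun x => (G.deleteEdges {e}).Reachable x (Quot.out e).1)).card)
      (((leaves G).filter
        (fun x => (G.deleteEdges {e}).Reachable x (Quot.out e).2)).card)

/-- The cost of an optimal perfect matching between the requests `req` (located at leaves)
and the `n` servers (one at each leaf), under the tree distance. -/
noncomputable def optMatch {V : Type*} [Fintype V] {G : SimpleGraph V} (hG : G.IsTree)
    (w : Sym2 V → ℝ) (n : ℕ) (req : Fin n → {x // x ∈ leaves G}) : ℝ :=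
  sInf {c : ℝ | ∃ π : Fin n ≃ {x // x ∈ leaves G},
    c = ∑ i : Fin n, treeDist hG w (req i : V) (π i : V)}

open Stirling in
theorem stirlingSeq_mul_le (a b : ℕ) :
    stirlingSeq (a + 1) * stirlingSeq (b + 1) ≤ 2 * stirlingSeq (a + b + 2) := by
  have anti : Antitone fun i : ℕ =>
      Real.log (stirlingSeq (i + 1)) - Real.log (stirlingSeq (i + 2)) := by
    intro i j hij
    refine hasSum_le (fun k => ?_) (log_stirlingSeq_sdiff_hasSum j)
      (log_stirlingSeq_sdiff_hasSum i)
    have : (i : ℝ) ≤ j := by exact_mod_cast hij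
    push_cast
    gcongr
  have pos (i : ℕ) : 0 < stirlingSeq (i + 1) := stirlingSeq'_pos i
  have base : stirlingSeq 1 * stirlingSeq 1 = 2 * stirlingSeq 2 := by
    have h4 : √(2 * (2 : ℕ) : ℝ) = 2 := by
      rw [show (2 * (2 : ℕ) : ℝ) = 2 ^ 2 by norm_num]; simp
    have h2 : √2 * √2 = (2 : ℝ) := Real.mul_self_sqrt (by norm_num)
    rw [stirlingSeq_one, div_mul_div_comm, h2, stirlingSeq, h4]
    have := Real.exp_ne_zero 1
    simp only [Nat.factorial]
    push_cast
    field_simp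
  have step (a b : ℕ) : Real.log (stirlingSeq (a + 1)) + Real.log (stirlingSeq (b + 1)) ≤
      Real.log 2 + Real.log (stirlingSeq (a + b + 2)) := by
    induction b with
    | zero =>
      induction a with
      | zero =>
        rw [← Real.log_mul (pos 0).ne' (pos 0).ne', ← Real.log_mul two_ne_zero (pos _).ne']
        exact (congrArg Real.log base).le
      | succ a ih =>
        have := anti (show a ≤ a + 1 by omega)
        simp only [add_assoc, add_zero, zero_add, Nat.reduceAdd] at this ih ⊢
        linarith
    | succ b ih =>
      have := anti (show b ≤ a + b + 1 by omega)
      simp only [add_assoc, Nat.reduceAdd] at this ih ⊢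
      linarith
  rw [← Real.log_le_log_iff (mul_pos (pos a) (pos b)) (mul_pos two_pos (pos _)),
    Real.log_mul (pos a).ne' (pos b).ne', Real.log_mul two_ne_zero (pos _).ne']
  exact step a b

open Stirling in
theorem factorial_eq_stirlingSeq (n : ℕ) (hn : 0 < n) :
    (n.factorial : ℝ) = stirlingSeq n * (√2 * √n * (n ^ n / Real.exp 1 ^ n)) := by
  have : (0 : ℝ) < n := by exact_mod_cast hn
  rw [stirlingSeq, ← div_pow, ← Real.sqrt_mul (by norm_num)]
  field_simp

/-- A lower bound for the central term of the binomial law `Bin(k + m, k / (k + m))`. -/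
theorem sqrt_le_choose_mul (k m : ℕ) (hk : 0 < k) (hm : 0 < m) :
    ((k + m : ℕ) : ℝ) ^ (k + m) * √(k * m / (2 * (k + m : ℕ))) ≤
      2 * (k * m / (k + m : ℕ)) * ((k + m).choose k * k ^ k * m ^ m) := by
  have hS : Stirling.stirlingSeq k * Stirling.stirlingSeq m ≤
      2 * Stirling.stirlingSeq (k + m) := by
    obtain ⟨a, rfl⟩ := Nat.exists_eq_succ_of_ne_zero hk.ne'
    obtain ⟨b, rfl⟩ := Nat.exists_eq_succ_of_ne_zero hm.ne'
    convert stirlingSeq_mul_le a b using 3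
    omega
  have pos (i : ℕ) (hi : 0 < i) : 0 < Stirling.stirlingSeq i := by
    obtain ⟨a, rfl⟩ := Nat.exists_eq_succ_of_ne_zero hi.ne'
    exact Stirling.stirlingSeq'_pos a
  have hn : 0 < k + m := by omega
  have hSk := pos k hk
  have hSm := pos m hm
  have hSn := pos _ hn
  have hk' : (0 : ℝ) < k := by exact_mod_cast hk
  have hm' : (0 : ℝ) < m := by exact_mod_cast hm
  have hn' : (0 : ℝ) < (k + m : ℕ) := by exact_mod_cast hn
  rw [Nat.cast_add_choose, factorial_eq_stirlingSeq _ hn, factorial_eq_stirlingSeq _ hk,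
    factorial_eq_stirlingSeq _ hm, Real.sqrt_div (by positivity),
    Real.sqrt_mul hk'.le, Real.sqrt_mul (by norm_num)]
  generalize Stirling.stirlingSeq k = A at *
  generalize Stirling.stirlingSeq m = B at *
  generalize Stirling.stirlingSeq (k + m) = C at *
  generalize ((k + m : ℕ) : ℝ) = N at *
  have hx := Real.sq_sqrt hk'.le
  have hy := Real.sq_sqrt hm'.le
  have hz := Real.sq_sqrt hn'.le
  have px := Real.sqrt_pos.2 hk'
  have py := Real.sqrt_pos.2 hm'
  have pz := Real.sqrt_pos.2 hn'
  have key : 2 * (k * m / N) * (C * (√2 * √N * (N ^ (k + m) / Real.exp 1 ^ (k + m))) /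
      (A * (√2 * √k * (k ^ k / Real.exp 1 ^ k)) * (B * (√2 * √m * (m ^ m / Real.exp 1 ^ m))))
      * k ^ k * m ^ m) = N ^ (k + m) * (√k * √m / (√2 * √N)) * (2 * C / (A * B)) := by
    rw [pow_add (Real.exp 1)]
    field_simp
    rw [hx, hy, hz]
    ring
  rw [key]
  refine le_mul_of_one_le_right (by positivity) ?_
  rwa [one_le_div (by positivity)]

/-- De Moivre's formula for the mean absolute deviation of `Bin(k + m, k / (k + m))`. -/
theorem sum_choose_mul_abs_sub (k m : ℕ) (hk : 0 < k) :
    ∑ j ∈ range (k + m + 1), ((k + m).choose j * k ^ j * m ^ (k + m - j) : ℝ) * |(j : ℝ) - k| =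
      2 * (k * m / (k + m : ℕ)) * ((k + m).choose k * k ^ k * m ^ m) := by
  have hn' : (0 : ℝ) < (k + m : ℕ) := by exact_mod_cast (show 0 < k + m by omega)
  set W : ℕ → ℝ := fun j => (k + m).choose j * k ^ j * m ^ (k + m - j) with hW
  set T : ℕ → ℝ := fun j => j * W j * m / (k + m : ℕ) with hT
  have diff (j : ℕ) (hj : j ≤ k + m) : W j * (j - k) = T j - T (j + 1) := by
    have hc : ((k + m).choose (j + 1) : ℝ) * (j + 1) = (k + m).choose j * ((k + m : ℕ) - j) := by
      rw [← Nat.cast_sub hj]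
      exact_mod_cast Nat.choose_succ_right_eq (k + m) j
    have hs : T (j + 1) = k * ((k + m : ℕ) - j) * W j / (k + m : ℕ) := by
      rcases hj.eq_or_lt with rfl | hlt
      · simp [hT, hW]
      · have hp : (m : ℝ) ^ (k + m - j) = m ^ (k + m - (j + 1)) * m := by
          rw [← pow_succ]; congr 1; omega
        simp only [hT, hW, hp, pow_succ]
        push_cast at hc ⊢
        congr 1
        linear_combination (k : ℝ) ^ j * k * m ^ (k + m - (j + 1)) * m * hc
    rw [hs]
    simp only [hT]
    field_simp
    push_cast
    ring
  have low : ∑ j ∈ range k, W j * |(j : ℝ) - k| = T k := by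
    have : ∀ j ∈ range k, W j * |(j : ℝ) - k| = T (j + 1) - T j := by
      intro j hj
      have hjk := mem_range.1 hj
      have : (j : ℝ) ≤ k := by exact_mod_cast hjk.le
      rw [abs_of_nonpos (by linarith)]
      linarith [diff j (by omega)]
    rw [sum_congr rfl this, sum_range_sub]
    simp [hT]
  have high : ∑ j ∈ range (m + 1), W (k + j) * |((k + j : ℕ) : ℝ) - k| = T k := by
    have : ∀ j ∈ range (m + 1), W (k + j) * |((k + j : ℕ) : ℝ) - k| =
        T (k + j) - T (k + (j + 1)) := by
      intro j hj
      have hjm := mem_range.1 hj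
      rw [← add_assoc, ← diff (k + j) (by omega), abs_of_nonneg (by push_cast; simp)]
    rw [sum_congr rfl this, sum_range_sub' fun j => T (k + j)]
    simp [hT, hW, ← add_assoc]
  rw [add_assoc, sum_range_add, low, high]
  simp only [hT, hW, Nat.add_sub_cancel_left]
  ring

/-- The law of the number of hits of a set `A` by a uniformly random tuple is binomial. -/
theorem sum_fun_card_filter {α : Type*} [Fintype α] [DecidableEq α] (n : ℕ) (A : Finset α) (F : ℕ → ℝ) :
    ∑ f : Fin n → α, F (#{i | f i ∈ A}) =
      ∑ j ∈ range (n + 1), (n.choose j * #A ^ j * #Aᶜ ^ (n - j) : ℝ) * F j := by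
  have fib (S : Finset (Fin n)) :
      ((univ.filter fun f : Fin n → α => ({i | f i ∈ A} : Finset (Fin n)) = S).card) =
        #A ^ #S * #Aᶜ ^ (n - #S) := by
    have : (univ.filter fun f : Fin n → α => ({i | f i ∈ A} : Finset (Fin n)) = S) =
        Fintype.piFinset fun i => if i ∈ S then A else Aᶜ := by
      ext f
      simp only [mem_filter, mem_univ, true_and, Fintype.mem_piFinset, Finset.ext_iff]
      refine forall_congr' fun i => ?_
      by_cases h : i ∈ S <;> simp [h]
    rw [this, Fintype.card_piFinset]
    simp only [apply_ite Finset.card, prod_ite, prod_const]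
    congr 2
    · simp
    · rw [filter_not, card_sdiff_of_subset (by simp)]; simp
  rw [← sum_fiberwise univ fun f : Fin n → α => ({i | f i ∈ A} : Finset (Fin n))]
  have inner (S : Finset (Fin n)) :
      ∑ f : Fin n → α with ({i | f i ∈ A} : Finset (Fin n)) = S, F (#{i | f i ∈ A}) =
        (#A ^ #S * #Aᶜ ^ (n - #S) : ℝ) * F #S := by
    rw [sum_congr rfl (g := fun _ => F #S) (by intro f hf; rw [(mem_filter.1 hf).2]),
      sum_const, fib, nsmul_eq_mul]
    push_cast
    rfl
  simp only [inner]
  rw [← powerset_univ, sum_powerset_apply_card fun j => (#A ^ j * #Aᶜ ^ (n - j) : ℝ) * F j]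
  simp [mul_assoc]

/-- The mean absolute deviation of the number of hits of `A` by a uniformly random tuple. -/
theorem sqrt_min_le_sum_abs {α : Type*} [Fintype α] [DecidableEq α] (n : ℕ) (hα : Fintype.card α = n)
    (A : Finset α) :
    (n : ℝ) ^ n * (1 / 2 * √(min #A #Aᶜ : ℕ)) ≤
      ∑ f : Fin n → α, |(#{i | f i ∈ A} : ℝ) - #A| := by
  rw [sum_fun_card_filter n A fun j => |(j : ℝ) - #A|]
  have hcard : n = #A + #Aᶜ := by rw [card_add_card_compl, hα]
  generalize #A = k at *
  generalize #Aᶜ = m at *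
  subst hcard
  rcases Nat.eq_zero_or_pos k with rfl | hk
  · simpa using sum_nonneg fun _ _ => by positivity
  rcases Nat.eq_zero_or_pos m with rfl | hm
  · simpa using sum_nonneg fun _ _ => by positivity
  rw [sum_choose_mul_abs_sub k m hk]
  refine le_trans ?_ (sqrt_le_choose_mul k m hk hm)
  have hk' : (0 : ℝ) < k := by exact_mod_cast hk
  have hm' : (0 : ℝ) < m := by exact_mod_cast hm
  gcongr
  rw [Real.le_sqrt' (by positivity), mul_pow, Real.sq_sqrt (by positivity),
    le_div_iff₀ (by positivity)]
  push_cast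
  rcases le_total (k : ℝ) m with h | h
  · rw [min_eq_left h]; nlinarith
  · rw [min_eq_right h]; nlinarith

theorem sum_map_eq_sum_ite {β : Type*} {l : List β} (hl : l.Nodup) (s : Finset β)
    (hs : ∀ e ∈ l, e ∈ s) (w : β → ℝ) :
    (l.map w).sum = ∑ e ∈ s, if e ∈ l then w e else 0 := by
  rw [← List.sum_toFinset w hl, ← sum_filter]
  congr 1
  ext e
  simpa using hs e

/-- The tree distance is at least the total weight of the edges separating `u` from `v`. -/
theorem sum_separating_le_treeDist {V : Type*} {G : SimpleGraph V} [Fintype G.edgeSet]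
    (hG : G.IsTree) (w : Sym2 V → ℝ) (hw : ∀ e, 0 ≤ w e) (u v : V) :
    ∑ e ∈ G.edgeFinset, (if (G.deleteEdges {e}).Reachable u v then 0 else w e) ≤
      treeDist hG w u v := by
  have hp := (hG.existsUnique_path u v).exists.choose_spec
  rw [treeDist, sum_map_eq_sum_ite hp.isTrail.edges_nodup G.edgeFinset fun e he => by
    simpa using SimpleGraph.Walk.edges_subset_edgeSet _ he]
  refine sum_le_sum fun e _ => ?_
  split_ifs with h₁ h₂ h₂
  · exact hw e
  · exact le_rfl
  · exact le_rfl
  · exact absurd ⟨SimpleGraph.Walk.toDeleteEdge e _ h₂⟩ h₁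

theorem abs_card_filter_sub_le_sum {α : Type*} [Fintype α] [DecidableEq α] (n : ℕ) (A : Finset α)
    (R : α → α → Prop) [DecidableRel R] (hR : ∀ x y, R x y → (x ∈ A ↔ y ∈ A)) (f : Fin n → α) (π : Fin n ≃ α) :
    |(#{i | f i ∈ A} : ℝ) - #A| ≤ ∑ i, if R (f i) (π i) then 0 else (1 : ℝ) := by
  have hf : (#{i | f i ∈ A} : ℝ) = ∑ i, if f i ∈ A then 1 else 0 := by simp
  have hπ : (#A : ℝ) = ∑ i, if π i ∈ A then 1 else 0 := by
    rw [Equiv.sum_comp π fun x => if x ∈ A then (1 : ℝ) else 0]; simp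
  rw [hf, hπ, ← sum_sub_distrib]
  refine (abs_sum_le_sum_abs _ _).trans (sum_le_sum fun i _ => ?_)
  have := hR (f i) (π i)
  split_ifs <;> simp_all

/-- The leaves on the side of the first endpoint of `e`, once `e` is deleted. -/
noncomputable def sideLeaves {V : Type*} [Fintype V] (G : SimpleGraph V) (e : Sym2 V) :
    Finset {x // x ∈ leaves G} :=
  univ.filter fun x => (G.deleteEdges {e}).Reachable x (Quot.out e).1

theorem smallSideLeaves_le {V : Type*} [Fintype V] [DecidableEq V] {G : SimpleGraph V} (hG : G.IsTree)
    {e : Sym2 V} (he : e ∈ G.edgeSet) :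
    smallSideLeaves G e ≤ min #(sideLeaves G e) #(sideLeaves G e)ᶜ := by
  have hbr : ¬ (G.deleteEdges {e}).Reachable (Quot.out e).1 (Quot.out e).2 := by
    have h := SimpleGraph.isAcyclic_iff_forall_isBridge.1 hG.isAcyclic he
    have hout : s((Quot.out e).1, (Quot.out e).2) = e := Quot.out_eq e
    rw [← hout, SimpleGraph.isBridge_iff, hout] at h
    exact h
  refine min_le_min ?_ ?_
  · rw [sideLeaves, ← card_map (Function.Embedding.subtype _)]
    refine card_le_card fun x hx => ?_
    simpa [and_comm] using hx
  · rw [sideLeaves, ← card_map (Function.Embedding.subtype _)]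
    refine card_le_card fun x hx => ?_
    obtain ⟨hl, hr⟩ : x ∈ leaves G ∧ (G.deleteEdges {e}).Reachable x (Quot.out e).2 := by
      simpa using hx
    simp only [mem_map, mem_compl, mem_filter, mem_univ, true_and]
    exact ⟨⟨x, hl⟩, fun h => hbr (h.symm.trans hr), rfl⟩

/-- Every perfect matching pays, on each edge, the imbalance between requests and servers. -/
theorem sum_imbalance_le_optMatch {V : Type*} [Fintype V] [DecidableEq V] {G : SimpleGraph V}
    [Fintype G.edgeSet] (hG : G.IsTree) (w : Sym2 V → ℝ) (hw : ∀ e, 0 ≤ w e)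
    (n : ℕ) (hL : (leaves G).card = n) (req : Fin n → {x // x ∈ leaves G}) :
    ∑ e ∈ G.edgeFinset, w e * |(#{i | req i ∈ sideLeaves G e} : ℝ) - #(sideLeaves G e)| ≤
      optMatch hG w n req := by
  refine le_csInf ⟨_, (Fintype.equivOfCardEq (by simp [hL])), rfl⟩ ?_
  rintro c ⟨π, rfl⟩
  refine le_trans ?_ (sum_le_sum fun i _ => sum_separating_le_treeDist hG w hw (req i) (π i))
  rw [sum_comm]
  refine sum_le_sum fun e _ => ?_
  have := abs_card_filter_sub_le_sum n (sideLeaves G e)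
    (fun x y => (G.deleteEdges {e}).Reachable x y) (fun x y h => by
      simp only [sideLeaves, mem_filter, mem_univ, true_and]
      exact ⟨h.symm.trans, h.trans⟩) req π
  refine (mul_le_mul_of_nonneg_left this (hw e)).trans (le_of_eq ?_)
  rw [mul_sum]
  exact sum_congr rfl fun i _ => by split_ifs <;> simp

/-- In a tree metric with `n` leaves (servers at the leaves) and `n` i.i.d. uniform
requests at the leaves, `E[OPT] ≥ (1/2)·∑_e d_e·√(n_e)`, where `n_e` is the number of
leaves on the smaller side of the edge `e`. -/
theorem stmt_16 {V : Type*} [Fintype V] [DecidableEq V] (G : SimpleGraph V)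
    (hG : G.IsTree) (w : Sym2 V → ℝ) (hw : ∀ e, 0 ≤ w e)
    (n : ℕ) (hn : 2 ≤ n) (hL : (leaves G).card = n) :
    (1 / 2) * ∑ e ∈ G.edgeFinset, w e * Real.sqrt (smallSideLeaves G e) ≤
      (∑ req : Fin n → {x // x ∈ leaves G}, optMatch hG w n req) / (n : ℝ) ^ n := by
  rw [le_div_iff₀ (by positivity), mul_assoc, sum_mul]
  calc (1 / 2) * ∑ e ∈ G.edgeFinset, w e * √(smallSideLeaves G e) * (n : ℝ) ^ n
      ≤ ∑ e ∈ G.edgeFinset, w e * ∑ req : Fin n → {x // x ∈ leaves G},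
          |(#{i | req i ∈ sideLeaves G e} : ℝ) - #(sideLeaves G e)| := by
        rw [mul_sum]
        refine sum_le_sum fun e he => ?_
        have h := sqrt_min_le_sum_abs n (by simp [hL]) (sideLeaves G e)
        have hs : √(smallSideLeaves G e) ≤
            √(min #(sideLeaves G e) #(sideLeaves G e)ᶜ : ℕ) :=
          Real.sqrt_le_sqrt (by
            exact_mod_cast smallSideLeaves_le hG (SimpleGraph.mem_edgeFinset.1 he))
        calc 1 / 2 * (w e * √(smallSideLeaves G e) * (n : ℝ) ^ n)
            = w e * ((n : ℝ) ^ n * (1 / 2 * √(smallSideLeaves G e))) := by ring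
          _ ≤ w e * ((n : ℝ) ^ n *
                (1 / 2 * √(min #(sideLeaves G e) #(sideLeaves G e)ᶜ : ℕ))) := by
              have := hw e
              gcongr
          _ ≤ _ := mul_le_mul_of_nonneg_left h (hw e)
    _ = ∑ req : Fin n → {x // x ∈ leaves G}, ∑ e ∈ G.edgeFinset,
          w e * |(#{i | req i ∈ sideLeaves G e} : ℝ) - #(sideLeaves G e)| := by
        simp only [mul_sum]
        exact sum_comm
    _ ≤ _ := sum_le_sum fun req _ => sum_imbalance_le_optMatch hG w hw n hL req
end

section
/- In a tree metric, for S_k consisting of k i.i.d. uniform samples from the n leaves, the expected optimal fractional transportation cost between S_k (supply 1/k each, with multiplicity) and all n leaves (demand 1/n each) satisfies E[M(S_k)] ≤ ∑_e d_e·√(n_e/(k n)). -/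
open Finset
open scoped Classical

/-- `M(S_k)`: the optimal fractional transportation cost between the multiset of samples
`σ` (each sample with supply `1/k`, counted with multiplicity) and the set of all leaves
(each with demand `1/n`), under the tree distance. -/
noncomputable def sampleTransport {V : Type*} [Fintype V] {G : SimpleGraph V}
    (hG : G.IsTree) (w : Sym2 V → ℝ) (k : ℕ)
    (σ : Fin k → {x // x ∈ leaves G}) : ℝ :=
  sInf {c : ℝ | ∃ x : Fin k → {l // l ∈ leaves G} → ℝ,
    (∀ i l, 0 ≤ x i l) ∧
    (∀ i, ∑ l, x i l = 1 / (k : ℝ)) ∧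
    (∀ l, ∑ i, x i l = 1 / ((leaves G).card : ℝ)) ∧
    c = ∑ i : Fin k, ∑ l : {l // l ∈ leaves G}, treeDist hG w (σ i : V) (l : V) * x i l}

/-- The unique path between two vertices of a tree. -/
noncomputable def treePath {V : Type*} {G : SimpleGraph V} (hG : G.IsTree) (u v : V) :
    G.Walk u v :=
  (hG.existsUnique_path u v).exists.choose

lemma treePath_length {V : Type*} {G : SimpleGraph V} (hG : G.IsTree) (u v : V) :
    (treePath hG u v).length = G.dist u v := by
  obtain ⟨p, hp, hl⟩ := hG.connected.exists_path_of_dist u v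
  have h : treePath hG u v = p :=
    (hG.existsUnique_path u v).unique (hG.existsUnique_path u v).exists.choose_spec hp
  rw [h, hl]

/-- The vertices lying on the tail side of the dart `d`. -/
def tailSide {V : Type*} (G : SimpleGraph V) (d : G.Dart) : Set V :=
  {x | (G.deleteEdges {d.edge}).Reachable x d.fst}

lemma count_edge_eq_count_add_count_symm {V : Type*} {G : SimpleGraph V} (d : G.Dart)
    {u v : V} (p : G.Walk u v) :
    p.edges.count d.edge = p.darts.count d + p.darts.count d.symm := by
  unfold SimpleGraph.Walk.edges
  induction p.darts with
  | nil => simp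
  | cons a l ih =>
    have hne : d ≠ d.symm := fun h => d.symm_ne h.symm
    have hiff : a.edge = d.edge ↔ a = d ∨ a = d.symm := SimpleGraph.dart_edge_eq_iff a d
    simp only [List.map_cons, List.count_cons, ih, beq_iff_eq, hiff]
    by_cases h1 : a = d
    · subst h1
      simp [hne]
      omega
    · by_cases h2 : a = d.symm
      · simp [h2, hne.symm]
        omega
      · simp [h1, h2]

lemma count_sub_count_symm {V : Type*} {G : SimpleGraph V} (hG : G.IsAcyclic) (d : G.Dart)
    {u v : V} (p : G.Walk u v) :
    (p.darts.count d : ℝ) - p.darts.count d.symm =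
      (tailSide G d).indicator 1 u - (tailSide G d).indicator 1 v := by
  have hfst : d.fst ∈ tailSide G d := SimpleGraph.Reachable.refl _
  have hsnd : d.snd ∉ tailSide G d := by
    have hb := SimpleGraph.isAcyclic_iff_forall_adj_isBridge.1 hG d.adj
    rw [SimpleGraph.isBridge_iff] at hb
    intro h
    exact hb (SimpleGraph.Reachable.symm h)
  have hne : d ≠ d.symm := fun h => d.symm_ne h.symm
  induction p with
  | nil => simp
  | @cons u v _ h p ih =>
    simp only [SimpleGraph.Walk.darts_cons, List.count_cons, beq_iff_eq]
    suffices hs : ((if (⟨(u, v), h⟩ : G.Dart) = d then (1 : ℝ) else 0) -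
        if (⟨(u, v), h⟩ : G.Dart) = d.symm then (1 : ℝ) else 0) =
        (tailSide G d).indicator 1 u - (tailSide G d).indicator 1 v by
      push_cast
      linarith
    by_cases h1 : (⟨(u, v), h⟩ : G.Dart) = d
    · subst h1
      simp_all
    · by_cases h2 : (⟨(u, v), h⟩ : G.Dart) = d.symm
      · have hd : d = (⟨(v, u), h.symm⟩ : G.Dart) := by
          rw [← d.symm_symm, ← h2]
          rfl
        have hu : u ∉ tailSide G d := by
          subst hd
          exact hsnd
        have hv : v ∈ tailSide G d := by
          subst hd
          exact hfst
        rw [if_neg h1, if_pos h2, Set.indicator_of_notMem hu, Set.indicator_of_mem hv]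
        simp
      · have hE : s(u, v) ≠ d.edge := fun he =>
          ((SimpleGraph.dart_edge_eq_iff ⟨(u, v), h⟩ d).1 he).elim h1 h2
        have hadj : (G.deleteEdges {d.edge}).Adj u v := by
          simp [SimpleGraph.deleteEdges_adj, h, hE]
        have hiff : u ∈ tailSide G d ↔ v ∈ tailSide G d :=
          ⟨fun hu => hadj.symm.reachable.trans hu, fun hv => hadj.reachable.trans hv⟩
        simp [h1, h2, Set.indicator, hiff]

lemma sum_map_edges_eq {V : Type*} [Fintype V] {G : SimpleGraph V} [Fintype G.edgeSet]
    (w : Sym2 V → ℝ) {u v : V} (p : G.Walk u v) :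
    (p.edges.map w).sum = ∑ e ∈ G.edgeFinset, w e * (p.edges.count e : ℝ) := by
  induction p with
  | nil => simp
  | @cons u v _ h p ih =>
    simp only [SimpleGraph.Walk.edges_cons, List.map_cons, List.sum_cons, ih, List.count_cons,
      beq_iff_eq, Nat.cast_add, mul_add, Finset.sum_add_distrib]
    rw [add_comm]
    congr 1
    simp [h]

lemma dist_add_one_add_dist_le_length {V : Type*} {G : SimpleGraph V} (hG : G.Connected)
    (d : G.Dart) {u v : V} (p : G.Walk u v) (hd : d ∈ p.darts) :
    G.dist u d.fst + 1 + G.dist d.snd v ≤ p.length := by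
  induction p with
  | nil => simp at hd
  | @cons u v x h p ih =>
    rw [SimpleGraph.Walk.darts_cons, List.mem_cons] at hd
    rw [SimpleGraph.Walk.length_cons]
    rcases hd with rfl | hd
    · have := SimpleGraph.dist_le p
      simp
      omega
    · have h1 := ih hd
      have h2 : G.dist u d.fst ≤ G.dist u v + G.dist v d.fst := hG.dist_triangle
      have h3 : G.dist u v = 1 := SimpleGraph.dist_eq_one_iff_adj.2 h
      omega

lemma dist_swap_lt {V : Type*} {G : SimpleGraph V} (hG : G.IsTree) (d : G.Dart) {u v u' v' : V}
    (h : d ∈ (treePath hG u v).darts) (h' : d.symm ∈ (treePath hG u' v').darts) :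
    G.dist u v' + G.dist u' v < G.dist u v + G.dist u' v' := by
  have h1 := dist_add_one_add_dist_le_length hG.connected d _ h
  have h2 := dist_add_one_add_dist_le_length hG.connected d.symm _ h'
  rw [treePath_length] at h1 h2
  have h3 : G.dist u v' ≤ G.dist u d.fst + G.dist d.fst v' := hG.connected.dist_triangle
  have h4 : G.dist u' v ≤ G.dist u' d.snd + G.dist d.snd v := hG.connected.dist_triangle
  simp only [SimpleGraph.Dart.symm] at h2
  simp only [Prod.fst_swap, Prod.snd_swap] at h2
  omega

/-- The transportation plans with row sums `r` and column sums `s`. -/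
def transportPlans {I J : Type*} [Fintype I] [Fintype J] (r : I → ℝ) (s : J → ℝ) :
    Set (I → J → ℝ) :=
  {x | (∀ i j, 0 ≤ x i j) ∧ (∀ i, ∑ j, x i j = r i) ∧ ∀ j, ∑ i, x i j = s j}

lemma isCompact_transportPlans {I J : Type*} [Fintype I] [Fintype J] (r : I → ℝ) (s : J → ℝ) :
    IsCompact (transportPlans r s) := by
  have hK : IsCompact (Set.pi Set.univ fun i : I =>
      Set.pi Set.univ fun _ : J => Set.Icc 0 (r i)) :=
    isCompact_univ_pi fun i => isCompact_univ_pi fun _ => isCompact_Icc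
  refine hK.of_isClosed_subset ?_ ?_
  · simp only [transportPlans, Set.ofPred_and, Set.ofPred_forall]
    refine IsClosed.inter ?_ (IsClosed.inter ?_ ?_)
    · exact isClosed_iInter fun i => isClosed_iInter fun j =>
        isClosed_le continuous_const (by fun_prop)
    · exact isClosed_iInter fun i => isClosed_eq (by fun_prop) continuous_const
    · exact isClosed_iInter fun j => isClosed_eq (by fun_prop) continuous_const
  · rintro x ⟨h0, hr, -⟩ i - j -
    exact ⟨h0 i j, hr i ▸ Finset.single_le_sum (fun j _ => h0 i j) (Finset.mem_univ j)⟩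

/-- A plan of minimal cost admits no improving swap. -/
lemma cost_add_le_of_isMinOn {I J : Type*} [Fintype I] [Fintype J] {r : I → ℝ} {s : J → ℝ}
    {c : I → J → ℝ} {x : I → J → ℝ} (hx : x ∈ transportPlans r s)
    (hmin : IsMinOn (fun y : I → J → ℝ => ∑ i, ∑ j, c i j * y i j) (transportPlans r s) x)
    {i i' : I} {j j' : J} (h : 0 < x i j) (h' : 0 < x i' j') :
    c i j + c i' j' ≤ c i j' + c i' j := by
  by_cases hi : i = i'
  · subst hi
    linarith
  by_cases hj : j = j'
  · subst hj
    linarith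
  obtain ⟨t, ht0, ht, ht'⟩ : ∃ t, 0 < t ∧ t ≤ x i j ∧ t ≤ x i' j' :=
    ⟨min (x i j) (x i' j'), lt_min h h', min_le_left _ _, min_le_right _ _⟩
  let α : I → ℝ := fun a => (if a = i then 1 else 0) - if a = i' then 1 else 0
  let β : J → ℝ := fun b => (if b = j' then 1 else 0) - if b = j then 1 else 0
  have hα : ∑ a, α a = 0 := by simp [α]
  have hβ : ∑ b, β b = 0 := by simp [β]
  let y : I → J → ℝ := fun a b => x a b + t * (α a * β b)
  have hy : y ∈ transportPlans r s := by
    refine ⟨fun a b => ?_, fun a => ?_, fun b => ?_⟩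
    · have h0 := hx.1 a b
      simp only [y, α, β]
      by_cases a1 : a = i <;> by_cases a2 : a = i' <;> by_cases b1 : b = j <;>
        by_cases b2 : b = j' <;> simp_all <;> linarith
    · simp only [y, Finset.sum_add_distrib, ← Finset.mul_sum, hβ, hx.2.1 a]
      simp
    · simp only [y, Finset.sum_add_distrib, ← Finset.mul_sum, ← Finset.sum_mul, hα, hx.2.2 b]
      simp
  have key : ∑ a, ∑ b, c a b * y a b =
      ∑ a, ∑ b, c a b * x a b + t * (c i j' + c i' j - c i j - c i' j') := by
    have : ∑ a, ∑ b, c a b * (α a * β b) = c i j' + c i' j - c i j - c i' j' := by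
      simp only [α, β, mul_sub, sub_mul, Finset.sum_sub_distrib]
      simp
      ring
    rw [← this]
    simp only [y, mul_add, Finset.sum_add_distrib, Finset.mul_sum]
    congr 1
    exact Finset.sum_congr rfl fun a _ => Finset.sum_congr rfl fun b _ => by ring
  have hle : ∑ a, ∑ b, c a b * x a b ≤ ∑ a, ∑ b, c a b * y a b := hmin hy
  rw [key] at hle
  have : 0 ≤ c i j' + c i' j - c i j - c i' j' := by
    by_contra hneg
    nlinarith
  linarith

/-- The mass that the plan `x` sends along the dart `d`. -/
noncomputable def dartFlow {V I J : Type*} [Fintype I] [Fintype J] {G : SimpleGraph V}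
    (hG : G.IsTree) (a : I → V) (b : J → V) (x : I → J → ℝ) (d : G.Dart) : ℝ :=
  ∑ i, ∑ j, x i j * ((treePath hG (a i) (b j)).darts.count d : ℝ)

lemma exists_of_dartFlow_pos {V I J : Type*} [Fintype I] [Fintype J] {G : SimpleGraph V}
    {hG : G.IsTree} {a : I → V} {b : J → V} {x : I → J → ℝ} (hx : ∀ i j, 0 ≤ x i j)
    {d : G.Dart} (h : 0 < dartFlow hG a b x d) :
    ∃ i j, 0 < x i j ∧ d ∈ (treePath hG (a i) (b j)).darts := by
  obtain ⟨i, -, hi⟩ := Finset.exists_lt_of_sum_lt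
    (show ∑ _i : I, (0 : ℝ) < ∑ i, _ by simpa [dartFlow] using h)
  obtain ⟨j, -, hj⟩ := Finset.exists_lt_of_sum_lt
    (show ∑ _j : J, (0 : ℝ) < ∑ j, _ by simpa using hi)
  refine ⟨i, j, (hx i j).lt_of_ne fun h0 => by simp [← h0] at hj, ?_⟩
  by_contra hd
  simp [List.count_eq_zero_of_not_mem hd] at hj

lemma dartFlow_sub_dartFlow_symm {V I J : Type*} [Fintype I] [Fintype J] {G : SimpleGraph V}
    (hG : G.IsTree) (a : I → V) (b : J → V) {r : I → ℝ} {s : J → ℝ} {x : I → J → ℝ}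
    (hx : x ∈ transportPlans r s) (d : G.Dart) :
    dartFlow hG a b x d - dartFlow hG a b x d.symm =
      ∑ i, r i * (tailSide G d).indicator 1 (a i) -
        ∑ j, s j * (tailSide G d).indicator 1 (b j) := by
  simp only [dartFlow, ← Finset.sum_sub_distrib, ← mul_sub,
    count_sub_count_symm hG.isAcyclic d]
  simp only [mul_sub, Finset.sum_sub_distrib, ← hx.2.1, ← hx.2.2, Finset.sum_mul]
  rw [Finset.sum_comm (s := (Finset.univ : Finset J))]

/-- The transportation upper bound on a tree: some plan costs at most the sum over the edges of
their length times the imbalance of their two sides. -/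
lemma exists_transportPlan_cost_le {V I J : Type*} [Fintype V] [Fintype I] [Fintype J]
    {G : SimpleGraph V} [Fintype G.edgeSet] (hG : G.IsTree) (w : Sym2 V → ℝ)
    (a : I → V) (b : J → V) {r : I → ℝ} {s : J → ℝ} (hne : (transportPlans r s).Nonempty) :
    ∃ x ∈ transportPlans r s, ∀ B : Sym2 V → ℝ,
      (∀ e ∈ G.edgeSet, 0 ≤ w e) →
      (∀ d : G.Dart, |∑ i, r i * (tailSide G d).indicator 1 (a i) -
        ∑ j, s j * (tailSide G d).indicator 1 (b j)| ≤ B d.edge) →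
      ∑ i, ∑ j, treeDist hG w (a i) (b j) * x i j ≤ ∑ e ∈ G.edgeFinset, w e * B e := by
  obtain ⟨x, hx, hmin⟩ := (isCompact_transportPlans r s).exists_isMinOn hne
    (f := fun y : I → J → ℝ => ∑ i, ∑ j, (G.dist (a i) (b j) : ℝ) * y i j)
    (Continuous.continuousOn (by fun_prop))
  refine ⟨x, hx, fun B hw hB => ?_⟩
  have hnn : ∀ d, 0 ≤ dartFlow hG a b x d := fun d =>
    Finset.sum_nonneg fun i _ => Finset.sum_nonneg fun j _ =>
      mul_nonneg (hx.1 i j) (Nat.cast_nonneg _)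
  have hone : ∀ d, dartFlow hG a b x d = 0 ∨ dartFlow hG a b x d.symm = 0 := by
    intro d
    by_contra! hcon
    obtain ⟨i, j, hij, hd⟩ := exists_of_dartFlow_pos hx.1 ((hnn d).lt_of_ne' hcon.1)
    obtain ⟨i', j', hij', hd'⟩ := exists_of_dartFlow_pos hx.1 ((hnn d.symm).lt_of_ne' hcon.2)
    have h1 := cost_add_le_of_isMinOn hx hmin hij hij'
    have h2 := dist_swap_lt hG d hd hd'
    norm_cast at h1
    omega
  have hflow : ∀ d : G.Dart, dartFlow hG a b x d + dartFlow hG a b x d.symm ≤ B d.edge := by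
    intro d
    have h1 := hB d
    rw [← dartFlow_sub_dartFlow_symm hG a b hx d] at h1
    refine le_trans ?_ h1
    rcases hone d with h | h <;> simp [h, abs_of_nonneg (hnn _)]
  calc ∑ i, ∑ j, treeDist hG w (a i) (b j) * x i j
      = ∑ e ∈ G.edgeFinset, w e *
          ∑ i, ∑ j, x i j * ((treePath hG (a i) (b j)).edges.count e : ℝ) := by
        have : ∀ u v, treeDist hG w u v =
            ∑ e ∈ G.edgeFinset, w e * ((treePath hG u v).edges.count e : ℝ) :=
          fun u v => sum_map_edges_eq w (treePath hG u v)
        simp only [this, Finset.mul_sum, Finset.sum_mul]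
        rw [Finset.sum_comm (s := G.edgeFinset)]
        refine Finset.sum_congr rfl fun i _ => ?_
        rw [Finset.sum_comm (s := G.edgeFinset)]
        refine Finset.sum_congr rfl fun j _ => Finset.sum_congr rfl fun e _ => ?_
        ring
    _ ≤ ∑ e ∈ G.edgeFinset, w e * B e := by
        refine Finset.sum_le_sum fun e he => ?_
        rw [SimpleGraph.mem_edgeFinset] at he
        refine mul_le_mul_of_nonneg_left ?_ (hw e he)
        induction e with
        | _ p q =>
          let d : G.Dart := ⟨(p, q), he⟩
          refine le_of_eq_of_le ?_ (hflow d)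
          have hc : ∀ u v, ((treePath hG u v).edges.count s(p, q) : ℝ) =
              (treePath hG u v).darts.count d + (treePath hG u v).darts.count d.symm := by
            intro u v
            exact_mod_cast count_edge_eq_count_add_count_symm d (treePath hG u v)
          simp only [hc, dartFlow, mul_add, Finset.sum_add_distrib]

lemma sum_sq_sum_of_sum_eq_zero {L : Type*} [Fintype L] (g : L → ℝ) (hg : ∑ l, g l = 0) (k : ℕ) :
    (∑ σ : Fin k → L, (∑ i, g (σ i)) ^ 2) * Fintype.card L =
      k * (Fintype.card L : ℝ) ^ k * ∑ l, g l ^ 2 := by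
  induction k with
  | zero => simp
  | succ k ih =>
    rw [← (Fin.consEquiv fun _ : Fin (k + 1) => L).sum_comp, Fintype.sum_prod_type]
    simp only [Fin.consEquiv_apply, Fin.sum_univ_succ, Fin.cons_zero, Fin.cons_succ, add_sq,
      Finset.sum_add_distrib, Finset.sum_const, ← Finset.mul_sum, ← Finset.sum_mul, hg,
      Finset.card_univ, nsmul_eq_mul, Fintype.card_fun, Fintype.card_fin]
    push_cast
    linear_combination (Fintype.card L : ℝ) * ih

lemma sum_abs_sum_le {L : Type*} [Fintype L] (g : L → ℝ) (hg : ∑ l, g l = 0) (k : ℕ)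
    (hL : 0 < Fintype.card L) :
    ∑ σ : Fin k → L, |∑ i, g (σ i)| ≤
      (Fintype.card L : ℝ) ^ k * √(k * (∑ l, g l ^ 2) / Fintype.card L) := by
  have hn : (0 : ℝ) < Fintype.card L := by exact_mod_cast hL
  have hsq := sq_sum_le_card_mul_sum_sq (s := (Finset.univ : Finset (Fin k → L)))
    (f := fun σ => |∑ i, g (σ i)|)
  simp only [sq_abs, Finset.card_univ, Fintype.card_fun, Fintype.card_fin, Nat.cast_pow] at hsq
  refine abs_le_of_sq_le_sq' (hsq.trans_eq ?_) (by positivity) |>.2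
  rw [mul_pow, Real.sq_sqrt (by positivity), eq_div_of_mul_eq hn.ne'
    (sum_sq_sum_of_sum_eq_zero g hg k)]
  ring

/-- The expected imbalance of a set of leaves under uniform sampling. -/
lemma sum_abs_sample_sub_le {L : Type*} [Fintype L] (A : Set L) (k : ℕ) (hk : 0 < k)
    (hL : 0 < Fintype.card L) :
    ∑ σ : Fin k → L, |∑ i, 1 / (k : ℝ) * A.indicator 1 (σ i) -
        ∑ l, 1 / (Fintype.card L : ℝ) * A.indicator 1 l| ≤
      (Fintype.card L : ℝ) ^ k * √((∑ l, A.indicator 1 l) / (k * Fintype.card L)) := by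
  have hn : (0 : ℝ) < Fintype.card L := by exact_mod_cast hL
  have hk' : (0 : ℝ) < k := by exact_mod_cast hk
  set N : ℝ := (Fintype.card L : ℝ) with hN
  set m : ℝ := ∑ l, A.indicator 1 l with hm
  let g : L → ℝ := fun l => A.indicator 1 l - m / N
  have hg : ∑ l, g l = 0 := by
    simp only [g, Finset.sum_sub_distrib, ← hm, Finset.sum_const, Finset.card_univ,
      nsmul_eq_mul, ← hN]
    field_simp
    simp
  have hg2 : ∑ l, g l ^ 2 ≤ m := by
    have hsq : ∀ l, g l ^ 2 = A.indicator 1 l - 2 * (m / N) * A.indicator 1 l + (m / N) ^ 2 := by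
      intro l
      by_cases h : l ∈ A
      · simp [g, h]
        ring
      · simp [g, h]
    simp only [hsq, Finset.sum_add_distrib, Finset.sum_sub_distrib, ← Finset.mul_sum, ← hm,
      Finset.sum_const, Finset.card_univ, nsmul_eq_mul, ← hN]
    have : m - 2 * (m / N) * m + N * (m / N) ^ 2 = m - m ^ 2 / N := by
      field_simp
      ring
    rw [this]
    have : 0 ≤ m ^ 2 / N := by positivity
    linarith
  have heq : ∀ σ : Fin k → L, |∑ i, 1 / (k : ℝ) * A.indicator 1 (σ i) -
      ∑ l, 1 / N * A.indicator 1 l| = 1 / k * |∑ i, g (σ i)| := by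
    intro σ
    rw [← abs_of_pos (show (0 : ℝ) < 1 / k by positivity), ← abs_mul,
      abs_of_pos (show (0 : ℝ) < 1 / k by positivity)]
    congr 1
    simp only [g, Finset.sum_sub_distrib, ← Finset.mul_sum, ← hm, Finset.sum_const,
      Finset.card_univ, nsmul_eq_mul, Fintype.card_fin]
    field_simp
  rw [Finset.sum_congr rfl fun σ _ => heq σ, ← Finset.mul_sum]
  have h1 := sum_abs_sum_le g hg k hL
  calc 1 / (k : ℝ) * ∑ σ : Fin k → L, |∑ i, g (σ i)|
      ≤ 1 / k * (N ^ k * √(k * m / N)) := by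
        refine mul_le_mul_of_nonneg_left (h1.trans ?_) (by positivity)
        gcongr
    _ = N ^ k * √(m / (k * N)) := by
        have : k * m / N = k ^ 2 * (m / (k * N)) := by field_simp
        rw [this, Real.sqrt_mul (by positivity), Real.sqrt_sq hk'.le]
        field_simp

/-- The bound on the expected transportation cost, with `n` the number of leaves. -/
lemma sum_sampleTransport_div_le {V : Type*} [Fintype V] (G : SimpleGraph V)
    [Fintype G.edgeSet] (hG : G.IsTree) (w : Sym2 V → ℝ) (hw : ∀ e, 0 ≤ w e)
    (k : ℕ) (hk : 0 < k) (hL : 0 < (leaves G).card) :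
    (∑ σ : Fin k → {x // x ∈ leaves G}, sampleTransport hG w k σ) /
        ((leaves G).card : ℝ) ^ k ≤
      ∑ e ∈ G.edgeFinset,
        w e * Real.sqrt ((smallSideLeaves G e : ℝ) / ((k : ℝ) * (leaves G).card)) := by
  have hn : (0 : ℝ) < (leaves G).card := by exact_mod_cast hL
  have hk' : (0 : ℝ) < k := by exact_mod_cast hk
  have hcard : Fintype.card {x // x ∈ leaves G} = (leaves G).card := Fintype.card_coe _
  let D : G.Dart → (Fin k → {x // x ∈ leaves G}) → ℝ := fun d σ =>
    |∑ i, 1 / (k : ℝ) * (tailSide G d).indicator 1 (σ i : V) -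
      ∑ l : {x // x ∈ leaves G},
        1 / ((leaves G).card : ℝ) * (tailSide G d).indicator 1 (l : V)|
  have hne : (transportPlans (fun _ : Fin k => 1 / (k : ℝ))
      (fun _ : {x // x ∈ leaves G} => 1 / ((leaves G).card : ℝ))).Nonempty := by
    refine ⟨fun _ _ => 1 / (k * (leaves G).card), fun _ _ => by positivity, fun _ => ?_,
      fun _ => ?_⟩ <;> simp <;> field_simp
  have hsymm : ∀ d σ, D d.symm σ = D d σ := by
    intro d σ
    obtain ⟨x, hx⟩ := hne
    have h1 := dartFlow_sub_dartFlow_symm hG (fun i => (σ i : V))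
      (fun l : {x // x ∈ leaves G} => (l : V)) hx d
    have h2 := dartFlow_sub_dartFlow_symm hG (fun i => (σ i : V))
      (fun l : {x // x ∈ leaves G} => (l : V)) hx d.symm
    rw [SimpleGraph.Dart.symm_symm] at h2
    simp only [D, ← h1, ← h2]
    exact abs_sub_comm _ _
  let B : (Fin k → {x // x ∈ leaves G}) → Sym2 V → ℝ := fun σ e =>
    if h : G.Adj (Quot.out e).1 (Quot.out e).2 then D ⟨Quot.out e, h⟩ σ else 0
  have hout : ∀ e : Sym2 V, s((Quot.out e).1, (Quot.out e).2) = e := fun e => Quot.out_eq e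
  have hadj : ∀ e ∈ G.edgeSet, G.Adj (Quot.out e).1 (Quot.out e).2 := by
    intro e he
    rw [← hout e] at he
    exact he
  have hB : ∀ σ d, D d σ ≤ B σ d.edge := by
    intro σ d
    have ha := hadj d.edge d.edge_mem
    simp only [B, dif_pos ha]
    rcases (SimpleGraph.dart_edge_eq_iff (⟨Quot.out d.edge, ha⟩ : G.Dart) d).1
      (hout d.edge) with h | h <;> rw [h]
    exact (hsymm d σ).ge
  have hM : ∀ σ, sampleTransport hG w k σ ≤ ∑ e ∈ G.edgeFinset, w e * B σ e := by
    intro σ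
    obtain ⟨x, hx, hcost⟩ := exists_transportPlan_cost_le hG w (fun i => (σ i : V))
      (fun l : {x // x ∈ leaves G} => (l : V)) hne
    refine le_trans (csInf_le ?_ ⟨x, hx.1, hx.2.1, hx.2.2, rfl⟩)
      (hcost (B σ) (fun e _ => hw e) fun d => hB σ d)
    refine ⟨0, ?_⟩
    rintro _ ⟨y, hy, -, -, rfl⟩
    refine Finset.sum_nonneg fun i _ => Finset.sum_nonneg fun l _ => mul_nonneg ?_ (hy i l)
    refine List.sum_nonneg fun c hc => ?_
    obtain ⟨e, -, rfl⟩ := List.mem_map.1 hc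
    exact hw e
  have hside : ∀ d : G.Dart, ∑ σ, D d σ ≤ ((leaves G).card : ℝ) ^ k *
      √((((leaves G).filter fun x => (G.deleteEdges {d.edge}).Reachable x d.fst).card : ℝ) /
        (k * (leaves G).card)) := by
    intro d
    have h := sum_abs_sample_sub_le (L := {x // x ∈ leaves G}) (Subtype.val ⁻¹' tailSide G d) k hk
      (by omega)
    have hc : (∑ l : {x // x ∈ leaves G}, (Subtype.val ⁻¹' tailSide G d).indicator 1 l : ℝ) =
        ((leaves G).filter fun x => (G.deleteEdges {d.edge}).Reachable x d.fst).card := by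
      refine (Finset.sum_coe_sort (leaves G)
        (fun x => (tailSide G d).indicator (1 : V → ℝ) x)).trans ?_
      simp [Set.indicator_apply, tailSide]
    rw [hc, hcard] at h
    exact h
  have hE : ∀ e ∈ G.edgeFinset, ∑ σ, B σ e ≤ ((leaves G).card : ℝ) ^ k *
      √((smallSideLeaves G e : ℝ) / (k * (leaves G).card)) := by
    intro e he
    have ha := hadj e (SimpleGraph.mem_edgeFinset.1 he)
    let d : G.Dart := ⟨Quot.out e, ha⟩
    have hde : d.edge = e := hout e
    have hBD : ∀ σ, B σ e = D d σ := fun σ => dif_pos ha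
    simp only [hBD]
    have h1 := hside d
    have h2 := hside d.symm
    simp only [hsymm] at h2
    rw [SimpleGraph.Dart.edge_symm] at h2
    rw [hde] at h1 h2
    rcases min_choice
      (((leaves G).filter fun x => (G.deleteEdges {e}).Reachable x (Quot.out e).1).card)
      (((leaves G).filter fun x => (G.deleteEdges {e}).Reachable x (Quot.out e).2).card)
      with h | h <;> rw [smallSideLeaves, h]
    · exact h1
    · exact h2
  rw [div_le_iff₀ (by positivity)]
  calc ∑ σ, sampleTransport hG w k σ
      ≤ ∑ σ, ∑ e ∈ G.edgeFinset, w e * B σ e := Finset.sum_le_sum fun σ _ => hM σ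
    _ = ∑ e ∈ G.edgeFinset, w e * ∑ σ, B σ e := by
        rw [Finset.sum_comm]
        simp only [Finset.mul_sum]
    _ ≤ ∑ e ∈ G.edgeFinset, w e * (((leaves G).card : ℝ) ^ k *
          √((smallSideLeaves G e : ℝ) / (k * (leaves G).card))) :=
        Finset.sum_le_sum fun e he => mul_le_mul_of_nonneg_left (hE e he) (hw e)
    _ = _ := by
        rw [Finset.sum_mul]
        exact Finset.sum_congr rfl fun e _ => by ring

/-- In a tree metric with `n` leaves, if `S_k` consists of `k` i.i.d. uniform samples
from the leaves, then `E[M(S_k)] ≤ ∑_e d_e·√(n_e/(k·n))`. -/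
theorem stmt_17 {V : Type*} [Fintype V] [DecidableEq V] (G : SimpleGraph V)
    (hG : G.IsTree) (w : Sym2 V → ℝ) (hw : ∀ e, 0 ≤ w e)
    (n k : ℕ) (hk : 0 < k) (hkn : k ≤ n) (hn : 2 ≤ n) (hL : (leaves G).card = n) :
    (∑ σ : Fin k → {x // x ∈ leaves G}, sampleTransport hG w k σ) / (n : ℝ) ^ k ≤
      ∑ e ∈ G.edgeFinset,
        w e * Real.sqrt ((smallSideLeaves G e : ℝ) / ((k : ℝ) * n)) := by
  subst hL
  exact sum_sampleTransport_div_le G hG w hw k hk (by omega)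
end
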